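/- Let n ≥ 1, s ∈ (0,1), 1 ≤ p < ∞ with sp < n, let Ω ⊂ ℝⁿ be a bounded open set, and let 1 ≤ q < p_s^* = np/(n − sp). Then for every sequence (u_k) of functions in C_c^∞(ℝⁿ) such that sup_k ( ‖u_k‖_{L^p(ℝⁿ)} + ‖D^s u_k‖_{L^p(ℝⁿ;ℝⁿ)} ) < ∞, there exists a subsequence (u_{k_j}) whose restrictions to Ω converge in L^q(Ω). (Compactness of the embedding H^{s,p}(ℝⁿ) ↪ L^q(Ω) in the subcritical case, where H^{s,p}(ℝⁿ) is the closure of C_c^∞(ℝⁿ) in the norm ‖u‖_{L^p} + ‖D^s u‖_{L^p}.) -/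

import Mathlib

open MeasureTheory Filter

noncomputable section

/-- The normalization constant `c_{n,s}` of the Riesz fractional gradient. -/
def cns (n : ℕ) (s : ℝ) : ℝ :=
  ((n : ℝ) + s - 1) * Real.Gamma (((n : ℝ) + s - 1) / 2) /
    (Real.pi ^ ((n : ℝ) / 2) * (2 : ℝ) ^ (1 - s) * Real.Gamma ((1 - s) / 2))

/-- The Riesz fractional gradient
`D^s u (x) = c_{n,s} ∫ (u(x) - u(y))/|x-y|^{n+s} ⬝ (x-y)/|x-y| dy`. -/
def rieszGrad (n : ℕ) (s : ℝ) (u : EuclideanSpace ℝ (Fin n) → ℝ)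
    (x : EuclideanSpace ℝ (Fin n)) : EuclideanSpace ℝ (Fin n) :=
  cns n s • ∫ y, ((u x - u y) / ‖x - y‖ ^ ((n : ℝ) + s + 1)) • (x - y)


/-! ### Elementary integrability facts -/

lemma intOn_min_rpow {a b : ℝ} (ha : a < 1) (hb : 1 < b) :
    IntegrableOn (fun t : ℝ => min (t ^ (-a)) (t ^ (-b))) (Set.Ioi 0) := by
  have hm : Measurable (fun t : ℝ => min (t ^ (-a)) (t ^ (-b))) := by fun_prop
  rw [← Set.Ioc_union_Ioi_eq_Ioi (zero_le_one (α := ℝ))]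
  refine IntegrableOn.union ?_ ?_
  · have h1 : IntegrableOn (fun t : ℝ => t ^ (-a)) (Set.Ioc 0 1) := by
      have := intervalIntegral.intervalIntegrable_rpow' (a := 0) (b := 1) (r := -a) (by linarith)
      rwa [intervalIntegrable_iff_integrableOn_Ioc_of_le zero_le_one] at this
    refine Integrable.mono' h1 hm.aestronglyMeasurable ?_
    refine (ae_restrict_iff' measurableSet_Ioc).2 (Eventually.of_forall fun t ht => ?_)
    have h0 : (0:ℝ) < t := ht.1
    rw [Real.norm_of_nonneg (by positivity)]
    exact min_le_left _ _
  · have h1 : IntegrableOn (fun t : ℝ => t ^ (-b)) (Set.Ioi 1) :=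
      integrableOn_Ioi_rpow_of_lt (by linarith) zero_lt_one
    refine Integrable.mono' h1 hm.aestronglyMeasurable ?_
    refine (ae_restrict_iff' measurableSet_Ioi).2 (Eventually.of_forall fun t ht => ?_)
    have h0 : (0:ℝ) < t := zero_lt_one.trans ht
    rw [Real.norm_of_nonneg (by positivity)]
    exact min_le_right _ _

lemma int_min_norm {n : ℕ} (hn : 1 ≤ n) {a b : ℝ} (ha : a < n) (hb : n < b) :
    Integrable (fun x : EuclideanSpace ℝ (Fin n) => min (‖x‖ ^ (-a)) (‖x‖ ^ (-b))) := by
  have : Nonempty (Fin n) := ⟨⟨0, hn⟩⟩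
  have key := (integrable_fun_norm_addHaar (volume : Measure (EuclideanSpace ℝ (Fin n)))
    (f := fun t : ℝ => min (t ^ (-a)) (t ^ (-b)))).2
  refine key ?_
  have h := intOn_min_rpow (a := a - n + 1) (b := b - n + 1) (by linarith) (by linarith)
  refine h.congr_fun (fun t ht => ?_) measurableSet_Ioi
  have ht0 : (0:ℝ) < t := ht
  simp only [finrank_euclideanSpace, Fintype.card_fin, smul_eq_mul]
  rw [mul_min_of_nonneg _ _ (by positivity), ← Real.rpow_natCast, ← Real.rpow_add ht0,
    ← Real.rpow_add ht0]
  push_cast [hn]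
  congr 2 <;> ring

lemma exp_neg_le_rpow {c : ℝ} (hc : 0 < c) {x : ℝ} (hx : 0 < x) :
    Real.exp (-x) ≤ c ^ c * x ^ (-c) := by
  have h1 : x / c ≤ Real.exp (x / c) := by linarith [Real.add_one_le_exp (x / c)]
  have h2 : (x / c) ^ c ≤ Real.exp x := by
    calc (x / c) ^ c ≤ (Real.exp (x / c)) ^ c :=
          Real.rpow_le_rpow (by positivity) h1 hc.le
      _ = Real.exp x := by rw [← Real.exp_mul]; congr 1; field_simp
  rw [Real.div_rpow hx.le hc.le] at h2
  rw [Real.exp_neg, Real.rpow_neg hx.le, inv_eq_one_div, div_le_iff₀ (Real.exp_pos x)]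
  rw [div_le_iff₀ (by positivity)] at h2
  have hxc : 0 < x ^ c := by positivity
  rw [mul_comm (c ^ c), mul_assoc, ← div_eq_inv_mul, le_div_iff₀ hxc]
  linarith

/-- The weight of the parametrix. -/
def wE (s ε τ : ℝ) : ℝ :=
  τ ^ ((s - 1) / 2) - (if ε < τ then (τ - ε) ^ ((s - 1) / 2) else 0)

lemma measurable_wE (s ε : ℝ) : Measurable (wE s ε) := by
  unfold wE
  refine Measurable.sub (by fun_prop) (Measurable.ite measurableSet_Ioi (by fun_prop) (by fun_prop))

lemma wE_bound_large {s τ : ℝ} (hs0 : 0 < s) (hs1 : s < 1) (hτ : 2 < τ) :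
    |wE s 1 τ| ≤ 2 * τ ^ ((s - 3) / 2) := by
  have hτ0 : 0 < τ := by linarith
  have h1 : (1:ℝ) < τ := by linarith
  have hx : τ - 1 = τ * (1 - τ⁻¹) := by field_simp
  have hi : τ⁻¹ < 1/2 := by
    rw [inv_eq_one_div, div_lt_div_iff₀ hτ0 (by norm_num)]; linarith
  have hi0 : 0 < τ⁻¹ := by positivity
  have hy : 0 < 1 - τ⁻¹ := by linarith
  have h2 : (1 - τ⁻¹) ^ ((s - 1) / 2) ≤ 1 + 2 * τ⁻¹ := by
    calc (1 - τ⁻¹) ^ ((s - 1) / 2) ≤ (1 - τ⁻¹) ^ (-1 : ℝ) :=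
          Real.rpow_le_rpow_of_exponent_ge hy (by linarith) (by linarith)
      _ = (1 - τ⁻¹)⁻¹ := Real.rpow_neg_one _
      _ ≤ 1 + 2 * τ⁻¹ := by
          rw [inv_eq_one_div, div_le_iff₀ hy]; nlinarith
  have h3 : 1 ≤ (1 - τ⁻¹) ^ ((s - 1) / 2) :=
    Real.one_le_rpow_of_pos_of_le_one_of_nonpos hy (by linarith) (by linarith)
  have h4 : τ ^ ((s - 3) / 2) = τ ^ ((s - 1) / 2) * τ⁻¹ := by
    rw [← Real.rpow_neg_one τ, ← Real.rpow_add hτ0]; congr 1; ring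
  have h5 : 0 < τ ^ ((s - 1) / 2) := by positivity
  unfold wE
  rw [if_pos h1, hx, Real.mul_rpow hτ0.le hy.le, h4, abs_le]
  constructor <;> nlinarith

lemma wE_moment_one {s b : ℝ} (hs0 : 0 < s) (hs1 : s < 1) (hb1 : -((s + 1) / 2) < b)
    (hb2 : b < (1 - s) / 2) :
    IntegrableOn (fun τ => |wE s 1 τ| * τ ^ b) (Set.Ioi 0) := by
  have hm : Measurable (fun τ : ℝ => |wE s 1 τ| * τ ^ b) := by
    have := measurable_wE s 1
    exact (this.abs).mul (by fun_prop)
  rw [← Set.Ioc_union_Ioi_eq_Ioi (zero_le_two (α := ℝ))]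
  refine IntegrableOn.union ?_ ?_
  · have h1 : IntegrableOn (fun t : ℝ => t ^ ((s - 1) / 2 + b)) (Set.Ioc 0 2) := by
      have := intervalIntegral.intervalIntegrable_rpow' (a := 0) (b := 2)
        (r := (s - 1) / 2 + b) (by linarith)
      rwa [intervalIntegrable_iff_integrableOn_Ioc_of_le zero_le_two] at this
    have h2 : IntegrableOn (fun t : ℝ => (t - 1) ^ ((s - 1) / 2)) (Set.Ioc 1 2) := by
      have := (intervalIntegral.intervalIntegrable_rpow' (a := 0) (b := 1)
        (r := (s - 1) / 2) (by linarith)).comp_sub_right 1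
      norm_num at this
      rwa [intervalIntegrable_iff_integrableOn_Ioc_of_le one_le_two] at this
    have h3 : IntegrableOn ((Set.Ioc (1:ℝ) 2).indicator
        (fun t : ℝ => (t - 1) ^ ((s - 1) / 2) * 2 ^ |b|)) (Set.Ioc 0 2) :=
      ((integrable_indicator_iff measurableSet_Ioc).2 (h2.mul_const _)).integrableOn
    refine Integrable.mono' (h1.add h3) hm.aestronglyMeasurable ?_
    refine (ae_restrict_iff' measurableSet_Ioc).2 (Eventually.of_forall fun t ht => ?_)
    have h0 : (0:ℝ) < t := ht.1
    rw [Real.norm_of_nonneg (by positivity)]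
    simp only [Pi.add_apply]
    rw [Real.rpow_add h0]
    have hp1 : 0 < t ^ ((s - 1) / 2) := by positivity
    have hpb : 0 < t ^ b := by positivity
    by_cases h : 1 < t
    · rw [Set.indicator_of_mem (show t ∈ Set.Ioc (1:ℝ) 2 from ⟨h, ht.2⟩)]
      unfold wE
      rw [if_pos h]
      have hq : 0 ≤ (t - 1) ^ ((s - 1) / 2) := Real.rpow_nonneg (by linarith) _
      have hb : t ^ b ≤ 2 ^ |b| :=
        (Real.rpow_le_rpow_of_exponent_le h.le (le_abs_self b)).trans
          (Real.rpow_le_rpow h0.le ht.2 (abs_nonneg b))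
      have : |t ^ ((s - 1) / 2) - (t - 1) ^ ((s - 1) / 2)| ≤
          t ^ ((s - 1) / 2) + (t - 1) ^ ((s - 1) / 2) := by
        rw [abs_le]; constructor <;> linarith
      nlinarith [mul_le_mul_of_nonneg_right this hpb.le, mul_le_mul_of_nonneg_left hb hq]
    · rw [Set.indicator_of_notMem (fun h' => h h'.1)]
      unfold wE
      rw [if_neg h, sub_zero, abs_of_pos hp1, add_zero]
  · have h1 : IntegrableOn (fun t : ℝ => 2 * t ^ ((s - 3) / 2 + b)) (Set.Ioi 2) :=
      (integrableOn_Ioi_rpow_of_lt (by linarith) zero_lt_two).const_mul 2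
    refine Integrable.mono' h1 hm.aestronglyMeasurable ?_
    refine (ae_restrict_iff' measurableSet_Ioi).2 (Eventually.of_forall fun t ht => ?_)
    have h0 : (0:ℝ) < t := zero_lt_two.trans ht
    rw [Real.norm_of_nonneg (by positivity), Real.rpow_add h0, ← mul_assoc]
    exact mul_le_mul_of_nonneg_right (wE_bound_large hs0 hs1 ht) (by positivity)

lemma wE_scale {s ε τ : ℝ} (hε : 0 < ε) (hτ : 0 < τ) :
    wE s ε τ = ε ^ ((s - 1) / 2) * wE s 1 (ε⁻¹ * τ) := by
  unfold wE
  have h1 : (ε < τ) ↔ (1 < ε⁻¹ * τ) := by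
    rw [← div_eq_inv_mul, lt_div_iff₀ hε, one_mul]
  rw [mul_sub, ← Real.mul_rpow hε.le (by positivity)]
  by_cases h : ε < τ
  · rw [if_pos h, if_pos (h1.1 h), ← Real.mul_rpow hε.le (by linarith [h1.1 h])]
    congr 2 <;> field_simp
  · rw [if_neg h, if_neg (fun h' => h (h1.2 h'))]
    congr 2
    · field_simp
    · simp

lemma wE_moment {s b ε : ℝ} (hs0 : 0 < s) (hs1 : s < 1) (hb1 : -((s + 1) / 2) < b)
    (hb2 : b < (1 - s) / 2) (hε : 0 < ε) :
    IntegrableOn (fun τ => |wE s ε τ| * τ ^ b) (Set.Ioi 0) ∧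
    ∫ τ in Set.Ioi 0, |wE s ε τ| * τ ^ b
      = ε ^ ((s + 1) / 2 + b) * ∫ τ in Set.Ioi 0, |wE s 1 τ| * τ ^ b := by
  have hpt : ∀ τ ∈ Set.Ioi (0:ℝ), |wE s ε τ| * τ ^ b =
      ε ^ ((s - 1) / 2 + b) * (fun x => |wE s 1 x| * x ^ b) (ε⁻¹ * τ) := by
    intro τ hτ
    have hτ0 : (0:ℝ) < τ := hτ
    simp only
    rw [wE_scale hε hτ0, abs_mul, abs_of_pos (by positivity : 0 < ε ^ ((s - 1) / 2)),
      Real.rpow_add hε, Real.mul_rpow (by positivity) hτ0.le, Real.inv_rpow hε.le]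
    field_simp
  constructor
  · refine IntegrableOn.congr_fun ?_ (fun τ hτ => (hpt τ hτ).symm) measurableSet_Ioi
    refine Integrable.const_mul ?_ _
    have := (integrableOn_Ioi_comp_mul_left_iff (fun x => |wE s 1 x| * x ^ b) 0
      (inv_pos.2 hε)).2 (by simpa using wE_moment_one hs0 hs1 hb1 hb2)
    exact this
  · rw [setIntegral_congr_fun measurableSet_Ioi hpt, integral_const_mul,
      integral_comp_mul_left_Ioi (fun x => |wE s 1 x| * x ^ b) 0 (inv_pos.2 hε)]
    simp only [mul_zero, inv_inv, smul_eq_mul]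
    rw [← mul_assoc]
    congr 1
    nth_rewrite 2 [← Real.rpow_one ε]
    rw [← Real.rpow_add hε]
    congr 1; ring

/-! ### Laplace transforms -/

lemma lap_int {a r : ℝ} (ha : 0 < a) (hr : 0 < r) :
    IntegrableOn (fun t : ℝ => t ^ (a - 1) * Real.exp (-(r * t))) (Set.Ioi 0) := by
  by_contra h
  have h1 := Real.integral_rpow_mul_exp_neg_mul_Ioi ha hr
  rw [integral_undef h] at h1
  have : 0 < (1 / r) ^ a * Real.Gamma a := mul_pos (by positivity) (Real.Gamma_pos_of_pos ha)
  linarith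

lemma lap_inv {b r : ℝ} (hb : 0 < b) (hr : 0 < r) :
    ∫ t in Set.Ioi (0:ℝ), t ^ (-b - 1) * Real.exp (-(r / t)) = (1 / r) ^ b * Real.Gamma b := by
  rw [← Real.integral_rpow_mul_exp_neg_mul_Ioi hb hr,
    ← integral_comp_rpow_Ioi (fun t : ℝ => t ^ (b - 1) * Real.exp (-(r * t)))
      (show (-1:ℝ) ≠ 0 by norm_num)]
  refine setIntegral_congr_fun measurableSet_Ioi fun t ht => ?_
  have ht0 : (0:ℝ) < t := ht
  simp only [smul_eq_mul, abs_neg, abs_one, one_mul]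
  rw [← mul_assoc, ← Real.rpow_mul ht0.le, ← Real.rpow_add ht0, Real.rpow_neg_one]
  congr 2
  ring

lemma lap_inv_int {b r : ℝ} (hb : 0 < b) (hr : 0 < r) :
    IntegrableOn (fun t : ℝ => t ^ (-b - 1) * Real.exp (-(r / t))) (Set.Ioi 0) := by
  by_contra h
  have h1 := lap_inv hb hr
  rw [integral_undef h] at h1
  have : 0 < (1 / r) ^ b * Real.Gamma b := mul_pos (by positivity) (Real.Gamma_pos_of_pos hb)
  linarith

lemma lap_wE {s ε r : ℝ} (hs0 : 0 < s) (hε : 0 < ε) (hr : 0 < r) :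
    ∫ τ in Set.Ioi (0:ℝ), wE s ε τ * Real.exp (-(r * τ)) =
      (1 / r) ^ ((s + 1) / 2) * Real.Gamma ((s + 1) / 2) * (1 - Real.exp (-(r * ε))) := by
  have ha : 0 < (s + 1) / 2 := by linarith
  have e1 : (s - 1) / 2 = (s + 1) / 2 - 1 := by ring
  have i1 := lap_int ha hr
  have h1 := Real.integral_rpow_mul_exp_neg_mul_Ioi ha hr
  set F : ℝ → ℝ := fun t => t ^ ((s + 1) / 2 - 1) * Real.exp (-(r * t)) with hF
  have hpt : ∀ τ, wE s ε τ * Real.exp (-(r * τ)) = F τ -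
      Real.exp (-(r * ε)) * (Set.Ioi ε).indicator (fun t => F (t - ε)) τ := by
    intro τ
    simp only [wE, e1, hF]
    by_cases h : ε < τ
    · rw [if_pos h, Set.indicator_of_mem (show τ ∈ Set.Ioi ε from h), sub_mul]
      have : Real.exp (-(r * τ)) = Real.exp (-(r * ε)) * Real.exp (-(r * (τ - ε))) := by
        rw [← Real.exp_add]; congr 1; ring
      nth_rewrite 2 [this]
      ring
    · rw [if_neg h, Set.indicator_of_notMem (show τ ∉ Set.Ioi ε from h)]
      ring
  have hpre : (fun x => x + ε) ⁻¹' Set.Ioi ε = Set.Ioi (0:ℝ) := by ext; simp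
  have mp := (measurePreserving_add_right (volume : Measure ℝ) ε)
  have me : MeasurableEmbedding (fun x : ℝ => x + ε) := measurableEmbedding_addRight ε
  have i2 : IntegrableOn (fun t => F (t - ε)) (Set.Ioi ε) := by
    rw [← mp.integrableOn_comp_preimage me, hpre]
    simpa [Function.comp_def] using i1
  have h2 : ∫ t in Set.Ioi ε, F (t - ε) = ∫ t in Set.Ioi 0, F t := by
    rw [← mp.setIntegral_preimage_emb me, hpre]
    simp
  have i3 : Integrable ((Set.Ioi ε).indicator (fun t => F (t - ε))) :=
    (integrable_indicator_iff measurableSet_Ioi).2 i2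
  simp_rw [hpt]
  rw [integral_sub i1 (i3.integrableOn.const_mul _), integral_const_mul,
    setIntegral_indicator measurableSet_Ioi, Set.Ioi_inter_Ioi, max_eq_right hε.le, h2, h1]
  ring

/-! ### Gaussians -/

/-- normalized Gaussian -/
def gK (n : ℕ) (t : ℝ) (y : EuclideanSpace ℝ (Fin n)) : ℝ :=
  t ^ (-((n : ℝ) / 2)) * Real.exp (-(Real.pi * ‖y‖ ^ 2 / t))

/-- (minus) derivative of the Gaussian, up to a constant -/
def hK (n : ℕ) (i : Fin n) (t : ℝ) (y : EuclideanSpace ℝ (Fin n)) : ℝ :=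
  y i / t * gK n t y

def CK (α : ℝ) : ℝ := ((α + 1) / 2) ^ ((α + 1) / 2) * Real.pi ^ (-((α + 1) / 2))

lemma CK_nonneg {α : ℝ} (hα : -1 < α) : 0 ≤ CK α := by
  have : 0 ≤ (α + 1) / 2 := by linarith
  unfold CK; positivity

lemma gK_pos (n : ℕ) {t : ℝ} (ht : 0 < t) (y : EuclideanSpace ℝ (Fin n)) : 0 < gK n t y := by
  unfold gK; positivity

lemma gK_bound (n : ℕ) {α t : ℝ} (hα : -1 < α) (ht : 0 < t) (y : EuclideanSpace ℝ (Fin n)) :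
    ‖y‖ / t * gK n t y ≤ CK α * (‖y‖ ^ (-α) * t ^ ((α - n - 1) / 2)) := by
  have hC := CK_nonneg hα
  rcases eq_or_ne y 0 with rfl | hy
  · simp only [norm_zero, zero_div, zero_mul]; positivity
  have hy0 : 0 < ‖y‖ := norm_pos_iff.2 hy
  have hc : 0 < (α + 1) / 2 := by linarith
  have h1 := exp_neg_le_rpow hc (x := Real.pi * ‖y‖ ^ 2 / t) (by positivity)
  have h2 : (Real.pi * ‖y‖ ^ 2 / t) ^ (-((α + 1) / 2)) =
      Real.pi ^ (-((α + 1) / 2)) * ‖y‖ ^ (-(α + 1)) * t ^ ((α + 1) / 2) := by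
    rw [Real.div_rpow (by positivity) ht.le, Real.mul_rpow (by positivity) (by positivity),
      ← Real.rpow_natCast, ← Real.rpow_mul hy0.le, Real.rpow_neg ht.le, div_inv_eq_mul]
    congr 3
    push_cast; ring
  rw [h2] at h1
  calc ‖y‖ / t * gK n t y ≤ ‖y‖ / t * (t ^ (-((n : ℝ) / 2)) * (((α + 1) / 2) ^ ((α + 1) / 2) *
        (Real.pi ^ (-((α + 1) / 2)) * ‖y‖ ^ (-(α + 1)) * t ^ ((α + 1) / 2)))) := by
        unfold gK; gcongr
    _ = CK α * ((‖y‖ ^ (1:ℝ) * ‖y‖ ^ (-(α + 1))) *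
          (t ^ (-1:ℝ) * t ^ (-((n : ℝ) / 2)) * t ^ ((α + 1) / 2))) := by
        rw [Real.rpow_neg_one, Real.rpow_one]; unfold CK; ring
    _ = _ := by
        rw [← Real.rpow_add hy0, ← Real.rpow_add ht, ← Real.rpow_add ht]
        congr 3 <;> ring

lemma abs_coord_le {n : ℕ} (y : EuclideanSpace ℝ (Fin n)) (i : Fin n) : |y i| ≤ ‖y‖ := by
  simpa using PiLp.norm_apply_le y i

lemma hK_bound (n : ℕ) (i : Fin n) {α t : ℝ} (hα : -1 < α) (ht : 0 < t)
    (y : EuclideanSpace ℝ (Fin n)) :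
    |hK n i t y| ≤ CK α * (‖y‖ ^ (-α) * t ^ ((α - n - 1) / 2)) := by
  refine le_trans ?_ (gK_bound n hα ht y)
  unfold hK
  rw [abs_mul, abs_div, abs_of_pos ht, abs_of_pos (gK_pos n ht y)]
  have := abs_coord_le y i
  have := gK_pos n ht y
  gcongr

lemma continuous_gK (n : ℕ) (t : ℝ) : Continuous (gK n t) := by
  unfold gK; fun_prop

lemma integrable_gK (n : ℕ) {t : ℝ} (ht : 0 < t) : Integrable (gK n t) := by
  by_contra h
  have h1 := GaussianFourier.integral_rexp_neg_mul_sq_norm (V := EuclideanSpace ℝ (Fin n))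
    (b := Real.pi / t) (by positivity)
  have h2 : 0 < (Real.pi / (Real.pi / t)) ^
      (Module.finrank ℝ (EuclideanSpace ℝ (Fin n)) / 2 : ℝ) := by positivity
  refine h (Integrable.const_mul ?_ _)
  have : Integrable (fun v : EuclideanSpace ℝ (Fin n) => Real.exp (-(Real.pi / t) * ‖v‖ ^ 2)) := by
    by_contra h'
    rw [integral_undef h'] at h1
    linarith
  refine this.congr (Eventually.of_forall fun v => ?_)
  simp only
  congr 1; ring

lemma integrable_norm_gK {n : ℕ} (hn : 1 ≤ n) {t : ℝ} (ht : 0 < t) :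
    Integrable (fun y => ‖y‖ * gK n t y) := by
  have h := int_min_norm hn (a := 0) (b := n + 1) (by exact_mod_cast hn) (by linarith)
  have hc := continuous_gK n t
  refine Integrable.mono' (h.const_mul (t * CK 0 * t ^ (((0:ℝ) - n - 1) / 2) +
    t * CK (n + 1) * t ^ ((((n:ℝ) + 1) - n - 1) / 2))) (by fun_prop)
    (Eventually.of_forall fun y => ?_)
  have hg := gK_pos n ht y
  rw [Real.norm_of_nonneg (by positivity)]
  have b1 := gK_bound n (α := 0) (by norm_num) ht y
  have b2 := gK_bound n (α := n + 1) (by linarith [(Nat.cast_nonneg n : (0:ℝ) ≤ n)]) ht y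
  have c1 := CK_nonneg (α := 0) (by norm_num)
  have c2 := CK_nonneg (α := n + 1) (by linarith [(Nat.cast_nonneg n : (0:ℝ) ≤ n)])
  have e : ‖y‖ * gK n t y = t * (‖y‖ / t * gK n t y) := by field_simp
  rw [e, add_mul]
  have p1 : 0 ≤ t * CK 0 * t ^ (((0:ℝ) - n - 1) / 2) := by positivity
  have p2 : 0 ≤ t * CK (n + 1) * t ^ ((((n:ℝ) + 1) - n - 1) / 2) := by positivity
  have m0 : 0 ≤ min (‖y‖ ^ (-(0:ℝ))) (‖y‖ ^ (-((n:ℝ) + 1))) := by positivity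
  rcases min_choice (‖y‖ ^ (-(0:ℝ))) (‖y‖ ^ (-((n:ℝ) + 1))) with hm | hm
  · have h1 := mul_le_mul_of_nonneg_left b1 ht.le
    have h2 := mul_nonneg p2 m0
    rw [hm] at h2 ⊢
    refine h1.trans (le_trans (le_of_eq ?_) (le_add_of_nonneg_right h2))
    generalize t ^ (((0:ℝ) - n - 1) / 2) = T
    ring
  · have h1 := mul_le_mul_of_nonneg_left b2 ht.le
    have h2 := mul_nonneg p1 m0
    rw [hm] at h2 ⊢
    refine h1.trans (le_trans (le_of_eq ?_) (le_add_of_nonneg_left h2))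
    generalize t ^ (((n:ℝ) + 1 - n - 1) / 2) = T
    ring

open FourierTransform

lemma fourier_gK (n : ℕ) {t : ℝ} (ht : 0 < t) (ξ : EuclideanSpace ℝ (Fin n)) :
    𝓕 (fun y => (gK n t y : ℂ)) ξ = Complex.exp (-(Real.pi * t * ‖ξ‖ ^ 2 : ℝ)) := by
  have h := fourier_gaussian_innerProductSpace (V := EuclideanSpace ℝ (Fin n))
    (b := ((Real.pi / t : ℝ) : ℂ)) (by rw [Complex.ofReal_re]; positivity) ξ
  have e : (fun y => (gK n t y : ℂ)) = ((t ^ (-((n : ℝ) / 2)) : ℝ) : ℂ) •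
      (fun v : EuclideanSpace ℝ (Fin n) =>
      Complex.exp (-((Real.pi / t : ℝ) : ℂ) * ‖v‖ ^ 2)) := by
    ext y
    simp only [gK, Pi.smul_apply, smul_eq_mul, Complex.ofReal_mul, Complex.ofReal_exp]
    congr 2
    push_cast; ring
  rw [e, Real.fourier_eq]
  simp only [Pi.smul_apply]
  simp_rw [smul_comm _ ((t ^ (-((n : ℝ) / 2)) : ℝ) : ℂ)]
  rw [integral_smul, ← Real.fourier_eq, h]
  have e2 : ((Real.pi : ℂ) / ((Real.pi / t : ℝ) : ℂ)) = ((t : ℝ) : ℂ) := by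
    push_cast
    have : (Real.pi : ℂ) ≠ 0 := by exact_mod_cast Real.pi_ne_zero
    field_simp
  have e3 : ((Module.finrank ℝ (EuclideanSpace ℝ (Fin n)) : ℂ) / 2) = (((n : ℝ) / 2 : ℝ) : ℂ) := by
    simp
  rw [e2, e3, ← Complex.ofReal_cpow ht.le, smul_eq_mul, ← mul_assoc, ← Complex.ofReal_mul,
    ← Real.rpow_add ht, neg_add_cancel, Real.rpow_zero, Complex.ofReal_one, one_mul]
  congr 1
  push_cast
  have : (Real.pi : ℂ) ≠ 0 := by exact_mod_cast Real.pi_ne_zero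
  have : (t : ℂ) ≠ 0 := by exact_mod_cast ht.ne'
  field_simp

lemma integrable_hK {n : ℕ} (hn : 1 ≤ n) (i : Fin n) {t : ℝ} (ht : 0 < t) :
    Integrable (hK n i t) := by
  have hc := continuous_gK n t
  refine Integrable.mono' ((integrable_norm_gK hn ht).const_mul t⁻¹)
    (by unfold hK; fun_prop) (Eventually.of_forall fun y => ?_)
  have hg := gK_pos n ht y
  unfold hK
  rw [norm_mul, norm_div, Real.norm_of_nonneg ht.le, Real.norm_of_nonneg hg.le, Real.norm_eq_abs,
    ← mul_assoc, ← div_eq_inv_mul]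
  have := abs_coord_le y i
  gcongr

lemma fourier_hK {n : ℕ} (hn : 1 ≤ n) (i : Fin n) {t : ℝ} (ht : 0 < t)
    (ξ : EuclideanSpace ℝ (Fin n)) :
    𝓕 (fun y => (hK n i t y : ℂ)) ξ =
      -Complex.I * (ξ i : ℂ) * Complex.exp (-(Real.pi * t * ‖ξ‖ ^ 2 : ℝ)) := by
  have h1 : Integrable (fun y => (gK n t y : ℂ)) := (integrable_gK n ht).ofReal
  have h2 : Integrable (fun y => ‖y‖ * ‖(gK n t y : ℂ)‖) := by
    refine (integrable_norm_gK hn ht).congr (Eventually.of_forall fun y => ?_)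
    simp only [Complex.norm_real, Real.norm_of_nonneg (gK_pos n ht y).le]
  have h := Real.fderiv_fourier h1 h2
  have h' := DFunLike.congr_fun (congrFun h ξ) (EuclideanSpace.single i (1:ℝ))
  have hf : (𝓕 (fun y => (gK n t y : ℂ))) = fun ξ : EuclideanSpace ℝ (Fin n) =>
      Complex.exp (-(Real.pi * t * ‖ξ‖ ^ 2 : ℝ)) := by
    ext ξ; exact fourier_gK n ht ξ
  rw [hf] at h'
  have hd : HasFDerivAt (fun ξ : EuclideanSpace ℝ (Fin n) =>
      Complex.exp (-(Real.pi * t * ‖ξ‖ ^ 2 : ℝ))) _ ξ :=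
    ((Complex.ofRealCLM.hasFDerivAt.comp ξ
      ((hasStrictFDerivAt_norm_sq ξ).hasFDerivAt.const_mul (Real.pi * t))).neg).cexp
  rw [hd.fderiv, Real.fourier_eq, ContinuousLinearMap.integral_apply] at h'
  · rw [Real.fourier_eq]
    have hin : ∀ y : EuclideanSpace ℝ (Fin n),
        inner ℝ y (EuclideanSpace.single i (1:ℝ)) = y i := by
      intro y; simp [EuclideanSpace.inner_single_right]
    have hin2 : ∀ y : EuclideanSpace ℝ (Fin n),
        (innerSL ℝ) y (EuclideanSpace.single i (1:ℝ)) = y i := hin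
    have e : ∀ y : EuclideanSpace ℝ (Fin n),
        (Real.fourierChar (-inner ℝ y ξ) • (VectorFourier.fourierSMulRight (innerSL ℝ)
          (fun y => (gK n t y : ℂ)) y)) (EuclideanSpace.single i (1:ℝ)) =
        (-(2 * Real.pi * Complex.I) * t) * (Real.fourierChar (-inner ℝ y ξ) • (hK n i t y : ℂ)) := by
      intro y
      simp [VectorFourier.fourierSMulRight_apply, hin2, hK, Circle.smul_def]
      have : (t : ℂ) ≠ 0 := by exact_mod_cast ht.ne'
      field_simp
    simp_rw [e] at h'
    rw [integral_const_mul] at h'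
    have hp : (Real.pi : ℂ) ≠ 0 := by exact_mod_cast Real.pi_ne_zero
    have ht' : (t : ℂ) ≠ 0 := by exact_mod_cast ht.ne'
    have hne : (-(2 * Real.pi * Complex.I) * t) ≠ 0 := by simp [ht.ne']
    refine mul_left_cancel₀ hne (h'.symm.trans ?_)
    simp [hin]
    ring_nf
    rw [Complex.I_sq]
    ring
  · refine (Real.fourierIntegral_convergent_iff ξ).2 ?_
    refine (h2.const_mul (2 * Real.pi * ‖innerSL ℝ (E := EuclideanSpace ℝ (Fin n))‖)).mono'
      h1.1.fourierSMulRight (Eventually.of_forall fun y => ?_)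
    exact (VectorFourier.norm_fourierSMulRight_le _ _ _).trans (le_of_eq (by ring))

/-! ### The parametrix kernel -/

def KK (n : ℕ) (s ε : ℝ) (i : Fin n) (y : EuclideanSpace ℝ (Fin n)) : ℝ :=
  ∫ τ in Set.Ioi (0:ℝ), wE s ε τ * hK n i τ y

def JJ (s b : ℝ) : ℝ := ∫ τ in Set.Ioi (0:ℝ), |wE s 1 τ| * τ ^ b

lemma JJ_nonneg (s b : ℝ) : 0 ≤ JJ s b :=
  setIntegral_nonneg measurableSet_Ioi fun τ hτ => by
    have : (0:ℝ) < τ := hτ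
    positivity

lemma measurable_hK_uncurry (n : ℕ) (i : Fin n) :
    Measurable (fun q : EuclideanSpace ℝ (Fin n) × ℝ => hK n i q.2 q.1) := by
  unfold hK gK; fun_prop

lemma KK_bound_aux {n : ℕ} {s α ε : ℝ} (hs0 : 0 < s) (hs1 : s < 1) (i : Fin n)
    (hα : -1 < α) (hα1 : n - s < α) (hα2 : α < n - s + 2) (hε : 0 < ε)
    (y : EuclideanSpace ℝ (Fin n)) :
    IntegrableOn (fun τ => wE s ε τ * hK n i τ y) (Set.Ioi 0) ∧
    ∫ τ in Set.Ioi (0:ℝ), |wE s ε τ * hK n i τ y| ≤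
      CK α * JJ s ((α - n - 1) / 2) * ε ^ ((s + α - n) / 2) * ‖y‖ ^ (-α) := by
  obtain ⟨m1, m2⟩ := wE_moment hs0 hs1 (b := (α - n - 1) / 2) (by linarith) (by linarith) hε
  have hm : Measurable (fun τ => wE s ε τ * hK n i τ y) :=
    (measurable_wE s ε).mul ((measurable_hK_uncurry n i).comp (by fun_prop : Measurable
      (fun τ : ℝ => (y, τ))))
  have hb : ∀ τ ∈ Set.Ioi (0:ℝ), |wE s ε τ * hK n i τ y| ≤
      (CK α * ‖y‖ ^ (-α)) * (|wE s ε τ| * τ ^ ((α - n - 1) / 2)) := by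
    intro τ hτ
    rw [abs_mul]
    have := mul_le_mul_of_nonneg_left (hK_bound n i hα hτ y) (abs_nonneg (wE s ε τ))
    linarith
  have hi : IntegrableOn (fun τ => wE s ε τ * hK n i τ y) (Set.Ioi 0) :=
    Integrable.mono' (m1.const_mul (CK α * ‖y‖ ^ (-α))) hm.aestronglyMeasurable
      ((ae_restrict_iff' measurableSet_Ioi).2 (Eventually.of_forall hb))
  refine ⟨hi, ?_⟩
  calc ∫ τ in Set.Ioi (0:ℝ), |wE s ε τ * hK n i τ y|
      ≤ ∫ τ in Set.Ioi (0:ℝ), (CK α * ‖y‖ ^ (-α)) * (|wE s ε τ| * τ ^ ((α - n - 1) / 2)) :=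
        setIntegral_mono_on hi.abs (m1.const_mul _) measurableSet_Ioi hb
    _ = _ := by
        rw [integral_const_mul, m2]
        have : (s + 1) / 2 + (α - n - 1) / 2 = (s + α - n) / 2 := by ring
        rw [this]; unfold JJ; ring

/-- the modulus controlling the parametrix -/
def om (n : ℕ) (s α β ε : ℝ) : ℝ :=
  CK α * JJ s ((α - n - 1) / 2) * ε ^ ((s + α - n) / 2) +
  CK β * JJ s ((β - n - 1) / 2) * ε ^ ((s + β - n) / 2)

/-- the profile controlling the parametrix -/
def prof (n : ℕ) (α β : ℝ) (y : EuclideanSpace ℝ (Fin n)) : ℝ := min (‖y‖ ^ (-α)) (‖y‖ ^ (-β))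

lemma prof_nonneg (n : ℕ) (α β : ℝ) (y : EuclideanSpace ℝ (Fin n)) : 0 ≤ prof n α β y := by
  unfold prof; positivity

lemma om_tendsto {n : ℕ} {s α β : ℝ} (hα1 : n - s < α) (hβ1 : n - s < β) :
    Tendsto (om n s α β) (nhdsWithin 0 (Set.Ioi 0)) (nhds 0) := by
  have h : ∀ c : ℝ, 0 < c → Tendsto (fun ε : ℝ => ε ^ c) (nhdsWithin 0 (Set.Ioi 0)) (nhds 0) := by
    intro c hc
    have := (Real.continuousAt_rpow_const 0 c (Or.inr hc.le)).tendsto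
    rw [Real.zero_rpow hc.ne'] at this
    exact this.mono_left nhdsWithin_le_nhds
  have := ((h ((s + α - n) / 2) (by linarith)).const_mul (CK α * JJ s ((α - n - 1) / 2))).add
    ((h ((s + β - n) / 2) (by linarith)).const_mul (CK β * JJ s ((β - n - 1) / 2)))
  rw [mul_zero, mul_zero, add_zero] at this
  exact this

lemma KK_bound_abs {n : ℕ} {s α β ε : ℝ} (hs0 : 0 < s) (hs1 : s < 1) (i : Fin n)
    (hα : -1 < α) (hα1 : n - s < α) (hα2 : α < n - s + 2)
    (hβ : -1 < β) (hβ1 : n - s < β) (hβ2 : β < n - s + 2) (hε : 0 < ε)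
    (y : EuclideanSpace ℝ (Fin n)) :
    ∫ τ in Set.Ioi (0:ℝ), |wE s ε τ * hK n i τ y| ≤ om n s α β ε * prof n α β y := by
  have h1 := (KK_bound_aux hs0 hs1 i hα hα1 hα2 hε y).2
  have h2 := (KK_bound_aux hs0 hs1 i hβ hβ1 hβ2 hε y).2
  have p1 := mul_nonneg (mul_nonneg (mul_nonneg (CK_nonneg hα) (JJ_nonneg s ((α - n - 1) / 2)))
    (Real.rpow_nonneg hε.le ((s + α - n) / 2))) (prof_nonneg n α β y)
  have p2 := mul_nonneg (mul_nonneg (mul_nonneg (CK_nonneg hβ) (JJ_nonneg s ((β - n - 1) / 2)))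
    (Real.rpow_nonneg hε.le ((s + β - n) / 2))) (prof_nonneg n α β y)
  unfold om
  rw [add_mul]
  rcases min_choice (‖y‖ ^ (-α)) (‖y‖ ^ (-β)) with hm | hm
  · rw [← hm] at h1
    exact h1.trans (le_add_of_nonneg_right p2)
  · rw [← hm] at h2
    exact h2.trans (le_add_of_nonneg_left p1)

lemma KK_bound {n : ℕ} {s α β ε : ℝ} (hs0 : 0 < s) (hs1 : s < 1) (i : Fin n)
    (hα : -1 < α) (hα1 : n - s < α) (hα2 : α < n - s + 2)
    (hβ : -1 < β) (hβ1 : n - s < β) (hβ2 : β < n - s + 2) (hε : 0 < ε)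
    (y : EuclideanSpace ℝ (Fin n)) :
    |KK n s ε i y| ≤ om n s α β ε * prof n α β y :=
  (abs_integral_le_integral_abs).trans
    (KK_bound_abs hs0 hs1 i hα hα1 hα2 hβ hβ1 hβ2 hε y)

lemma KK_prod_int {n : ℕ} (hn : 1 ≤ n) {s ε : ℝ} (hs0 : 0 < s) (hs1 : s < 1) (i : Fin n)
    (hε : 0 < ε) :
    Integrable (fun q : EuclideanSpace ℝ (Fin n) × ℝ => wE s ε q.2 * hK n i q.2 q.1)
      (volume.prod (volume.restrict (Set.Ioi 0))) := by
  have hn' : (1:ℝ) ≤ n := by exact_mod_cast hn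
  have hm : Measurable (fun q : EuclideanSpace ℝ (Fin n) × ℝ => wE s ε q.2 * hK n i q.2 q.1) :=
    ((measurable_wE s ε).comp measurable_snd).mul (measurable_hK_uncurry n i)
  rw [integrable_prod_iff hm.aestronglyMeasurable]
  constructor
  · refine Eventually.of_forall fun y => ?_
    exact (KK_bound_aux hs0 hs1 i (α := n) (by linarith) (by linarith) (by linarith) hε y).1
  · have hp := (int_min_norm hn (a := n - s / 2) (b := n + 1 - s) (by linarith) (by linarith))
    refine Integrable.mono' (hp.const_mul (om n s (n - s / 2) (n + 1 - s) ε)) ?_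
      (Eventually.of_forall fun y => ?_)
    · exact (hm.norm.stronglyMeasurable.integral_prod_right').aestronglyMeasurable
    · simp only [Real.norm_eq_abs]
      rw [abs_of_nonneg (integral_nonneg fun _ => abs_nonneg _)]
      exact KK_bound_abs hs0 hs1 i (by linarith) (by linarith) (by linarith) (by linarith)
        (by linarith) (by linarith) hε y

lemma KK_integrable {n : ℕ} (hn : 1 ≤ n) {s ε : ℝ} (hs0 : 0 < s) (hs1 : s < 1) (i : Fin n)
    (hε : 0 < ε) : Integrable (KK n s ε i) :=
  (KK_prod_int hn hs0 hs1 i hε).integral_prod_left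

open FourierTransform

lemma fourier_KK {n : ℕ} (hn : 1 ≤ n) {s ε : ℝ} (hs0 : 0 < s) (hs1 : s < 1) (i : Fin n)
    (hε : 0 < ε) (ξ : EuclideanSpace ℝ (Fin n)) :
    𝓕 (fun y => (KK n s ε i y : ℂ)) ξ = -Complex.I * (ξ i : ℂ) *
      ((∫ τ in Set.Ioi (0:ℝ), wE s ε τ * Real.exp (-(Real.pi * ‖ξ‖ ^ 2 * τ)) : ℝ) : ℂ) := by
  rw [Real.fourier_eq]
  have hI := (KK_prod_int hn hs0 hs1 i hε).ofReal (𝕜 := ℂ)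
  have hI2 : Integrable (Function.uncurry fun (y : EuclideanSpace ℝ (Fin n)) (τ : ℝ) =>
      Real.fourierChar (-inner ℝ y ξ) • ((wE s ε τ * hK n i τ y : ℝ) : ℂ))
      (volume.prod (volume.restrict (Set.Ioi 0))) := by
    refine hI.mono ?_ (Eventually.of_forall fun q => by simp [Function.uncurry])
    exact (Real.continuous_fourierChar.comp (by fun_prop :
      Continuous fun q : EuclideanSpace ℝ (Fin n) × ℝ => -inner ℝ q.1 ξ)
      ).aestronglyMeasurable.smul hI.aestronglyMeasurable
  calc ∫ y, Real.fourierChar (-inner ℝ y ξ) • (KK n s ε i y : ℂ)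
      = ∫ y, ∫ τ in Set.Ioi (0:ℝ),
          Real.fourierChar (-inner ℝ y ξ) • ((wE s ε τ * hK n i τ y : ℝ) : ℂ) := by
        refine integral_congr_ae (Eventually.of_forall fun y => ?_)
        simp only [Circle.smul_def]
        rw [integral_smul, integral_complex_ofReal]
        rfl
    _ = ∫ τ in Set.Ioi (0:ℝ), ∫ y,
          Real.fourierChar (-inner ℝ y ξ) • ((wE s ε τ * hK n i τ y : ℝ) : ℂ) :=
        integral_integral_swap hI2
    _ = ∫ τ in Set.Ioi (0:ℝ), (-Complex.I * (ξ i : ℂ)) *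
          ((wE s ε τ * Real.exp (-(Real.pi * ‖ξ‖ ^ 2 * τ)) : ℝ) : ℂ) := by
        refine setIntegral_congr_fun measurableSet_Ioi fun τ hτ => ?_
        have h := fourier_hK hn i hτ ξ
        rw [Real.fourier_eq] at h
        simp only [Complex.ofReal_mul]
        have e : ∀ y : EuclideanSpace ℝ (Fin n), Real.fourierChar (-inner ℝ y ξ) •
            ((wE s ε τ : ℂ) * (hK n i τ y : ℂ)) = (wE s ε τ : ℂ) *
            (Real.fourierChar (-inner ℝ y ξ) • (hK n i τ y : ℂ)) := by
          intro y; simp only [Circle.smul_def, smul_eq_mul]; ring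
        simp_rw [e]
        rw [integral_const_mul, h]
        push_cast
        ring_nf
    _ = _ := by rw [integral_const_mul, integral_complex_ofReal]

/-! ### The singular kernel -/

def kk (n : ℕ) (s : ℝ) (i : Fin n) (z : EuclideanSpace ℝ (Fin n)) : ℝ :=
  z i * ‖z‖ ^ (-((n : ℝ) + s + 1))

def AA (n : ℕ) (s : ℝ) : ℝ :=
  Real.pi ^ (-(((n : ℝ) + s + 1) / 2)) * Real.Gamma (((n : ℝ) + s + 1) / 2)

lemma AA_pos (n : ℕ) {s : ℝ} (hs0 : 0 < s) : 0 < AA n s := by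
  have : 0 < Real.Gamma (((n : ℝ) + s + 1) / 2) := Real.Gamma_pos_of_pos (by positivity)
  unfold AA; positivity

lemma kk_eq (n : ℕ) {s : ℝ} (hs0 : 0 < s) (i : Fin n) (z : EuclideanSpace ℝ (Fin n)) :
    IntegrableOn (fun t : ℝ => t ^ (-((s + 1) / 2)) * hK n i t z) (Set.Ioi 0) ∧
    ∫ t in Set.Ioi (0:ℝ), t ^ (-((s + 1) / 2)) * hK n i t z = AA n s * kk n s i z ∧
    ∫ t in Set.Ioi (0:ℝ), |t ^ (-((s + 1) / 2)) * hK n i t z| = AA n s * |kk n s i z| := by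
  rcases eq_or_ne z 0 with rfl | hz
  · simp [hK, kk, IntegrableOn]
  have hz0 : 0 < ‖z‖ := norm_pos_iff.2 hz
  have hb : 0 < ((n : ℝ) + s + 1) / 2 := by positivity
  have hr : 0 < Real.pi * ‖z‖ ^ 2 := by positivity
  have hpt : ∀ t ∈ Set.Ioi (0:ℝ), t ^ (-((s + 1) / 2)) * hK n i t z =
      z i * (t ^ (-(((n : ℝ) + s + 1) / 2) - 1) * Real.exp (-(Real.pi * ‖z‖ ^ 2 / t))) := by
    intro t ht
    have ht0 : (0:ℝ) < t := ht
    have : t ^ (-(((n : ℝ) + s + 1) / 2) - 1) =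
        t ^ (-((s + 1) / 2)) * t ^ (-1 : ℝ) * t ^ (-((n : ℝ) / 2)) := by
      rw [← Real.rpow_add ht0, ← Real.rpow_add ht0]; congr 1; ring
    rw [this, Real.rpow_neg_one]
    unfold hK gK
    ring
  have hpt2 : ∀ t ∈ Set.Ioi (0:ℝ), |t ^ (-((s + 1) / 2)) * hK n i t z| =
      |z i| * (t ^ (-(((n : ℝ) + s + 1) / 2) - 1) * Real.exp (-(Real.pi * ‖z‖ ^ 2 / t))) := by
    intro t ht
    have ht0 : (0:ℝ) < t := ht
    rw [hpt t ht, abs_mul, abs_of_pos (by positivity : 0 < t ^ (-(((n : ℝ) + s + 1) / 2) - 1) *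
      Real.exp (-(Real.pi * ‖z‖ ^ 2 / t)))]
  have e : (1 / (Real.pi * ‖z‖ ^ 2)) ^ (((n : ℝ) + s + 1) / 2) *
      Real.Gamma (((n : ℝ) + s + 1) / 2) = AA n s * ‖z‖ ^ (-((n : ℝ) + s + 1)) := by
    unfold AA
    rw [one_div, Real.inv_rpow (by positivity), ← Real.rpow_neg (by positivity),
      Real.mul_rpow (by positivity) (by positivity), ← Real.rpow_natCast, ← Real.rpow_mul hz0.le]
    have : ((2:ℕ):ℝ) * -(((n : ℝ) + s + 1) / 2) = -((n : ℝ) + s + 1) := by push_cast; ring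
    rw [this]; ring
  refine ⟨?_, ?_, ?_⟩
  · exact IntegrableOn.congr_fun ((lap_inv_int hb hr).const_mul (z i))
      (fun t ht => (hpt t ht).symm) measurableSet_Ioi
  · rw [setIntegral_congr_fun measurableSet_Ioi hpt, integral_const_mul, lap_inv hb hr, e]
    unfold kk; ring
  · rw [setIntegral_congr_fun measurableSet_Ioi hpt2, integral_const_mul, lap_inv hb hr, e]
    unfold kk
    rw [abs_mul, abs_of_pos (by positivity : 0 < ‖z‖ ^ (-((n : ℝ) + s + 1)))]; ring

lemma measurable_kk (n : ℕ) (s : ℝ) (i : Fin n) : Measurable (kk n s i) := by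
  unfold kk; fun_prop

lemma kk_bound (n : ℕ) {s : ℝ} (i : Fin n) (z : EuclideanSpace ℝ (Fin n)) :
    |kk n s i z| ≤ ‖z‖ ^ (-((n : ℝ) + s)) := by
  rcases eq_or_ne z 0 with rfl | hz
  · simp only [kk, PiLp.zero_apply, zero_mul, abs_zero]; positivity
  have hz0 : 0 < ‖z‖ := norm_pos_iff.2 hz
  unfold kk
  rw [abs_mul, abs_of_pos (by positivity : 0 < ‖z‖ ^ (-((n : ℝ) + s + 1)))]
  calc |z i| * ‖z‖ ^ (-((n : ℝ) + s + 1)) ≤ ‖z‖ ^ (1:ℝ) * ‖z‖ ^ (-((n : ℝ) + s + 1)) := by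
        rw [Real.rpow_one]
        gcongr
        exact abs_coord_le z i
    _ = _ := by rw [← Real.rpow_add hz0]; congr 1; ring

/-- generic bound: a factor that is `≤ min(‖z‖,1)` tames the singular kernel -/
lemma kk_min_bound (n : ℕ) {s : ℝ} (i : Fin n) (z : EuclideanSpace ℝ (Fin n))
    {a C : ℝ} (h1 : a ≤ C * ‖z‖) (h2 : a ≤ C) (hC : 0 ≤ C) :
    a * |kk n s i z| ≤ C * min (‖z‖ ^ (-((n : ℝ) + s - 1))) (‖z‖ ^ (-((n : ℝ) + s))) := by
  rcases eq_or_ne z 0 with rfl | hz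
  · simp only [kk, PiLp.zero_apply, zero_mul, abs_zero, mul_zero]; positivity
  have hz0 : 0 < ‖z‖ := norm_pos_iff.2 hz
  have hk := kk_bound n (s := s) i z
  have hk0 := abs_nonneg (kk n s i z)
  rw [mul_min_of_nonneg _ _ hC]
  refine le_min ?_ ?_
  · calc a * |kk n s i z| ≤ (C * ‖z‖) * ‖z‖ ^ (-((n : ℝ) + s)) := by gcongr
      _ = C * (‖z‖ ^ (1:ℝ) * ‖z‖ ^ (-((n : ℝ) + s))) := by rw [Real.rpow_one]; ring
      _ = _ := by rw [← Real.rpow_add hz0]; congr 2; ring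
  · gcongr

lemma int_kk_min {n : ℕ} (hn : 1 ≤ n) {s : ℝ} (hs0 : 0 < s) (hs1 : s < 1) :
    Integrable (fun z : EuclideanSpace ℝ (Fin n) =>
      min (‖z‖ ^ (-((n : ℝ) + s - 1))) (‖z‖ ^ (-((n : ℝ) + s)))) :=
  int_min_norm hn (by linarith) (by linarith)

/-! ### Symbol of the fractional gradient -/

lemma fourierChar_sub_bound (r : ℝ) :
    ‖1 - (Real.fourierChar (-r) : ℂ)‖ ≤ 2 * Real.pi * |r| ∧
    ‖1 - (Real.fourierChar (-r) : ℂ)‖ ≤ 2 := by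
  constructor
  · rw [norm_sub_rev, Real.fourierChar_apply]
    have h := Real.norm_exp_I_mul_ofReal_sub_one_le (x := 2 * Real.pi * (-r))
    rw [mul_comm] at h
    refine h.trans (le_of_eq ?_)
    rw [norm_mul, Real.norm_eq_abs, Real.norm_eq_abs, abs_neg, abs_of_pos (by positivity)]
  · refine (norm_sub_le _ _).trans ?_
    simp only [norm_one, Circle.norm_coe]
    norm_num

lemma symbol_kk {n : ℕ} (hn : 1 ≤ n) {s : ℝ} (hs0 : 0 < s) (hs1 : s < 1) (i : Fin n)
    (ξ : EuclideanSpace ℝ (Fin n)) :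
    (AA n s : ℂ) * ∫ z, (1 - (Real.fourierChar (-inner ℝ z ξ) : ℂ)) * (kk n s i z : ℂ) =
      Complex.I * (ξ i : ℂ) * ((∫ t in Set.Ioi (0:ℝ),
        t ^ (-((s + 1) / 2)) * Real.exp (-(Real.pi * ‖ξ‖ ^ 2 * t)) : ℝ) : ℂ) := by
  have hcont : Continuous (fun z : EuclideanSpace ℝ (Fin n) =>
      1 - (Real.fourierChar (-inner ℝ z ξ) : ℂ)) := by
    have := Real.continuous_fourierChar
    fun_prop
  have hmeas : Measurable (fun q : EuclideanSpace ℝ (Fin n) × ℝ =>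
      (1 - (Real.fourierChar (-inner ℝ q.1 ξ) : ℂ)) *
        ((q.2 ^ (-((s + 1) / 2)) * hK n i q.2 q.1 : ℝ) : ℂ)) := by
    refine (hcont.measurable.comp measurable_fst).mul (Complex.measurable_ofReal.comp ?_)
    exact (measurable_snd.pow_const _).mul (measurable_hK_uncurry n i)
  have hI2 : Integrable (Function.uncurry fun (z : EuclideanSpace ℝ (Fin n)) (t : ℝ) =>
      (1 - (Real.fourierChar (-inner ℝ z ξ) : ℂ)) *
        ((t ^ (-((s + 1) / 2)) * hK n i t z : ℝ) : ℂ))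
      (volume.prod (volume.restrict (Set.Ioi 0))) := by
    refine (integrable_prod_iff hmeas.aestronglyMeasurable).2 ⟨?_, ?_⟩
    · refine Eventually.of_forall fun z => ?_
      exact ((kk_eq n hs0 i z).1.ofReal (𝕜 := ℂ)).const_mul
        (1 - (Real.fourierChar (-inner ℝ z ξ) : ℂ))
    · refine Integrable.mono' ((int_kk_min hn hs0 hs1).const_mul
        (AA n s * (2 * Real.pi * ‖ξ‖ + 2))) ?_ (Eventually.of_forall fun z => ?_)
      · exact (hmeas.norm.stronglyMeasurable.integral_prod_right').aestronglyMeasurable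
      · rw [Real.norm_of_nonneg (integral_nonneg fun _ => norm_nonneg _)]
        simp only [norm_mul, Complex.norm_real]
        rw [integral_const_mul]
        simp only [Real.norm_eq_abs, ← abs_mul]
        rw [(kk_eq n hs0 i z).2.2]
        obtain ⟨b1, b2⟩ := fourierChar_sub_bound (inner ℝ z ξ)
        have hin : |inner ℝ z ξ| ≤ ‖z‖ * ‖ξ‖ := abs_real_inner_le_norm z ξ
        have hA := AA_pos n hs0
        have := kk_min_bound n (s := s) i z (a := ‖1 - (Real.fourierChar (-inner ℝ z ξ) : ℂ)‖)
          (C := 2 * Real.pi * ‖ξ‖ + 2) (b1.trans (by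
            have := mul_le_mul_of_nonneg_left hin (by positivity : 0 ≤ 2 * Real.pi)
            nlinarith [norm_nonneg z])) (b2.trans (by
              have : 0 ≤ 2 * Real.pi * ‖ξ‖ := by positivity
              linarith)) (by positivity)
        calc _ = AA n s * (‖1 - (Real.fourierChar (-inner ℝ z ξ) : ℂ)‖ * |kk n s i z|) := by ring
          _ ≤ _ := by rw [mul_assoc]; exact mul_le_mul_of_nonneg_left this hA.le
  calc (AA n s : ℂ) * ∫ z, (1 - (Real.fourierChar (-inner ℝ z ξ) : ℂ)) * (kk n s i z : ℂ)
      = ∫ z, ∫ t in Set.Ioi (0:ℝ), (1 - (Real.fourierChar (-inner ℝ z ξ) : ℂ)) *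
        ((t ^ (-((s + 1) / 2)) * hK n i t z : ℝ) : ℂ) := by
        rw [← integral_const_mul]
        refine integral_congr_ae (Eventually.of_forall fun z => ?_)
        simp only
        rw [integral_const_mul, integral_complex_ofReal, (kk_eq n hs0 i z).2.1]
        push_cast; ring
    _ = ∫ t in Set.Ioi (0:ℝ), ∫ z, (1 - (Real.fourierChar (-inner ℝ z ξ) : ℂ)) *
        ((t ^ (-((s + 1) / 2)) * hK n i t z : ℝ) : ℂ) := integral_integral_swap hI2
    _ = ∫ t in Set.Ioi (0:ℝ), (Complex.I * (ξ i : ℂ)) *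
        ((t ^ (-((s + 1) / 2)) * Real.exp (-(Real.pi * ‖ξ‖ ^ 2 * t)) : ℝ) : ℂ) := by
        refine setIntegral_congr_fun measurableSet_Ioi fun t ht => ?_
        have h := fourier_hK hn i ht ξ
        have h0 := fourier_hK hn i ht 0
        rw [Real.fourier_eq] at h h0
        have hig : Integrable (fun z => (hK n i t z : ℂ)) := (integrable_hK hn i ht).ofReal
        have hig2 := (Real.fourierIntegral_convergent_iff ξ).2 hig
        simp only [inner_zero_right, neg_zero, AddChar.map_zero_eq_one, one_smul,
          PiLp.zero_apply, Complex.ofReal_zero, mul_zero, zero_mul] at h0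
        simp only [Complex.ofReal_mul]
        have e : ∀ z : EuclideanSpace ℝ (Fin n), (1 - (Real.fourierChar (-inner ℝ z ξ) : ℂ)) *
            (((t ^ (-((s + 1) / 2)) : ℝ) : ℂ) * (hK n i t z : ℂ)) =
            ((t ^ (-((s + 1) / 2)) : ℝ) : ℂ) * ((hK n i t z : ℂ) -
              (Real.fourierChar (-inner ℝ z ξ) • (hK n i t z : ℂ))) := by
          intro z; simp only [Circle.smul_def, smul_eq_mul]; ring
        simp_rw [e]
        rw [integral_const_mul, integral_sub hig hig2, h, h0]
        push_cast
        ring_nf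
    _ = _ := by rw [integral_const_mul, integral_complex_ofReal]

/-! ### Components of the fractional gradient of a test function -/

def dd (n : ℕ) (s : ℝ) (u : EuclideanSpace ℝ (Fin n) → ℝ) (i : Fin n)
    (x : EuclideanSpace ℝ (Fin n)) : ℝ :=
  ∫ z, (u x - u (x - z)) * kk n s i z

lemma u_lip {n : ℕ} {u : EuclideanSpace ℝ (Fin n) → ℝ} (hu : ContDiff ℝ (⊤ : ℕ∞) u)
    (hc : HasCompactSupport u) :
    ∃ C : ℝ, 0 ≤ C ∧ ∀ x z, |u x - u (x - z)| ≤ C * ‖z‖ ∧ |u x - u (x - z)| ≤ C := by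
  obtain ⟨L, hL⟩ := hu.lipschitzWith_of_hasCompactSupport hc (by simp)
  obtain ⟨M, hM⟩ := hc.exists_bound_of_continuous hu.continuous
  have hM0 : 0 ≤ M := (norm_nonneg _).trans (hM 0)
  refine ⟨L + 2 * M, by positivity, fun x z => ⟨?_, ?_⟩⟩
  · have := hL.dist_le_mul x (x - z)
    rw [Real.dist_eq, dist_eq_norm, sub_sub_cancel] at this
    nlinarith [norm_nonneg z]
  · have h1 := hM x
    have h2 := hM (x - z)
    rw [Real.norm_eq_abs] at h1 h2
    have := abs_sub (u x) (u (x - z))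
    have := L.2
    have h3 : (0:ℝ) ≤ L := L.coe_nonneg
    linarith

lemma u_int {n : ℕ} {u : EuclideanSpace ℝ (Fin n) → ℝ} (hu : ContDiff ℝ (⊤ : ℕ∞) u)
    (hc : HasCompactSupport u) : Integrable u := hu.continuous.integrable_of_hasCompactSupport hc

lemma u_diff_int {n : ℕ} {u : EuclideanSpace ℝ (Fin n) → ℝ} (hu : ContDiff ℝ (⊤ : ℕ∞) u)
    (hc : HasCompactSupport u) (z : EuclideanSpace ℝ (Fin n)) :
    Integrable (fun x => u x - u (x - z)) :=
  (u_int hu hc).sub ((u_int hu hc).comp_sub_right z)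

lemma u_L1 {n : ℕ} {u : EuclideanSpace ℝ (Fin n) → ℝ} (hu : ContDiff ℝ (⊤ : ℕ∞) u)
    (hc : HasCompactSupport u) :
    ∃ C : ℝ, 0 ≤ C ∧ ∀ z, (∫ x, |u x - u (x - z)|) ≤ C * ‖z‖ ∧ (∫ x, |u x - u (x - z)|) ≤ C := by
  obtain ⟨L, hL0, hL⟩ := u_lip hu hc
  have hi := u_int hu hc
  obtain ⟨R, hR⟩ := hc.isCompact.isBounded.subset_closedBall 0
  set V : ℝ := (volume : Measure (EuclideanSpace ℝ (Fin n))).real (Metric.closedBall 0 (R + 1))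
    with hV
  have hV0 : 0 ≤ V := measureReal_nonneg
  set N : ℝ := ∫ x, |u x| with hN
  have hN0 : 0 ≤ N := integral_nonneg fun _ => abs_nonneg _
  have hb : ∀ z, (∫ x, |u x - u (x - z)|) ≤ 2 * N := by
    intro z
    calc (∫ x, |u x - u (x - z)|) ≤ ∫ x, (|u x| + |u (x - z)|) :=
          integral_mono (u_diff_int hu hc z).abs (hi.abs.add (hi.comp_sub_right z).abs)
            fun x => abs_sub _ _
      _ = N + N := by
          rw [integral_add hi.abs (hi.comp_sub_right z).abs,
            integral_sub_right_eq_self (fun x => |u x|) z]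
      _ = 2 * N := by ring
  refine ⟨L * V + 2 * N, by positivity, fun z => ⟨?_, ?_⟩⟩
  · by_cases hz : ‖z‖ ≤ 1
    · have hsupp : ∀ x, x ∉ Metric.closedBall (0 : EuclideanSpace ℝ (Fin n)) (R + 1) →
          |u x - u (x - z)| = 0 := by
        intro x hx
        rw [mem_closedBall_zero_iff, not_le] at hx
        have h0 : ∀ w : EuclideanSpace ℝ (Fin n), R < ‖w‖ → u w = 0 := by
          intro w hw
          refine image_eq_zero_of_notMem_tsupport fun h' => ?_
          have := hR h'
          rw [mem_closedBall_zero_iff] at this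
          linarith
        have h2 : ‖x‖ ≤ ‖x - z‖ + ‖z‖ := by simpa using norm_add_le (x - z) z
        rw [h0 x (by linarith), h0 (x - z) (by linarith)]
        simp
      rw [← setIntegral_eq_integral_of_forall_compl_eq_zero hsupp]
      calc (∫ x in Metric.closedBall (0 : EuclideanSpace ℝ (Fin n)) (R + 1), |u x - u (x - z)|)
          ≤ ∫ x in Metric.closedBall (0 : EuclideanSpace ℝ (Fin n)) (R + 1), L * ‖z‖ :=
            integral_mono (u_diff_int hu hc z).abs.integrableOn
              (integrableOn_const measure_closedBall_lt_top.ne) fun x => (hL x z).1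
        _ = V * (L * ‖z‖) := by rw [setIntegral_const, smul_eq_mul]
        _ ≤ _ := by nlinarith [norm_nonneg z, mul_nonneg hN0 (norm_nonneg z)]
    · have := hb z
      push Not at hz
      nlinarith [mul_nonneg hL0 hV0]
  · have := hb z
    nlinarith [mul_nonneg hL0 hV0]

lemma dd_integrand_int {n : ℕ} (hn : 1 ≤ n) {s : ℝ} (hs0 : 0 < s) (hs1 : s < 1)
    {u : EuclideanSpace ℝ (Fin n) → ℝ} (hu : ContDiff ℝ (⊤ : ℕ∞) u)
    (hc : HasCompactSupport u) (i : Fin n) (x : EuclideanSpace ℝ (Fin n)) :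
    Integrable (fun z => (u x - u (x - z)) * kk n s i z) := by
  obtain ⟨L, hL0, hL⟩ := u_lip hu hc
  have hcont := hu.continuous
  refine Integrable.mono' ((int_kk_min hn hs0 hs1).const_mul L) ?_
    (Eventually.of_forall fun z => ?_)
  · exact ((by fun_prop : Continuous fun z => u x - u (x - z)).measurable.mul
      (measurable_kk n s i)).aestronglyMeasurable
  · rw [norm_mul]
    exact kk_min_bound n i z (hL x z).1 (hL x z).2 hL0

lemma dd_cont {n : ℕ} (hn : 1 ≤ n) {s : ℝ} (hs0 : 0 < s) (hs1 : s < 1)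
    {u : EuclideanSpace ℝ (Fin n) → ℝ} (hu : ContDiff ℝ (⊤ : ℕ∞) u)
    (hc : HasCompactSupport u) (i : Fin n) :
    Continuous (dd n s u i) ∧ ∃ C, ∀ x, |dd n s u i x| ≤ C := by
  obtain ⟨L, hL0, hL⟩ := u_lip hu hc
  have hcont := hu.continuous
  have hb : ∀ x z, ‖(u x - u (x - z)) * kk n s i z‖ ≤ L *
      min (‖z‖ ^ (-((n : ℝ) + s - 1))) (‖z‖ ^ (-((n : ℝ) + s))) := by
    intro x z
    rw [norm_mul]
    exact kk_min_bound n i z (hL x z).1 (hL x z).2 hL0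
  constructor
  · refine continuous_of_dominated (fun x => (dd_integrand_int hn hs0 hs1 hu hc i x).1)
      (fun x => Eventually.of_forall (hb x)) ((int_kk_min hn hs0 hs1).const_mul L)
      (Eventually.of_forall fun z => by fun_prop)
  · refine ⟨_, fun x => norm_integral_le_of_norm_le ((int_kk_min hn hs0 hs1).const_mul L)
      (Eventually.of_forall (hb x))⟩

lemma dd_prod_int {n : ℕ} (hn : 1 ≤ n) {s : ℝ} (hs0 : 0 < s) (hs1 : s < 1)
    {u : EuclideanSpace ℝ (Fin n) → ℝ} (hu : ContDiff ℝ (⊤ : ℕ∞) u)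
    (hc : HasCompactSupport u) (i : Fin n) :
    Integrable (fun q : EuclideanSpace ℝ (Fin n) × EuclideanSpace ℝ (Fin n) =>
      (u q.1 - u (q.1 - q.2)) * kk n s i q.2) (volume.prod volume) := by
  obtain ⟨C, hC0, hC⟩ := u_L1 hu hc
  have hcont := hu.continuous
  have hm : Measurable (fun q : EuclideanSpace ℝ (Fin n) × EuclideanSpace ℝ (Fin n) =>
      (u q.1 - u (q.1 - q.2)) * kk n s i q.2) :=
    (by fun_prop : Continuous fun q : EuclideanSpace ℝ (Fin n) × EuclideanSpace ℝ (Fin n) =>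
      u q.1 - u (q.1 - q.2)).measurable.mul ((measurable_kk n s i).comp measurable_snd)
  rw [integrable_prod_iff' hm.aestronglyMeasurable]
  constructor
  · exact Eventually.of_forall fun z => (u_diff_int hu hc z).mul_const (kk n s i z)
  · refine Integrable.mono' ((int_kk_min hn hs0 hs1).const_mul C) ?_
      (Eventually.of_forall fun z => ?_)
    · exact (hm.norm.stronglyMeasurable.integral_prod_left').aestronglyMeasurable
    · rw [Real.norm_of_nonneg (integral_nonneg fun _ => norm_nonneg _)]
      simp only [norm_mul, Real.norm_eq_abs]
      rw [integral_mul_const]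
      exact kk_min_bound n i z (hC z).1 (hC z).2 hC0

lemma dd_int {n : ℕ} (hn : 1 ≤ n) {s : ℝ} (hs0 : 0 < s) (hs1 : s < 1)
    {u : EuclideanSpace ℝ (Fin n) → ℝ} (hu : ContDiff ℝ (⊤ : ℕ∞) u)
    (hc : HasCompactSupport u) (i : Fin n) : Integrable (dd n s u i) :=
  (dd_prod_int hn hs0 hs1 hu hc i).integral_prod_left

open FourierTransform

lemma fourier_shift {n : ℕ} (f : EuclideanSpace ℝ (Fin n) → ℂ)
    (z ξ : EuclideanSpace ℝ (Fin n)) :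
    ∫ x, Real.fourierChar (-inner ℝ x ξ) • f (x - z) =
      (Real.fourierChar (-inner ℝ z ξ) : ℂ) * 𝓕 f ξ := by
  rw [Real.fourier_eq,
    ← integral_sub_right_eq_self (fun x => Real.fourierChar (-inner ℝ x ξ) • f x) z,
    ← integral_const_mul]
  refine integral_congr_ae (Eventually.of_forall fun x => ?_)
  simp only [Circle.smul_def, smul_eq_mul]
  rw [← mul_assoc, ← Circle.coe_mul, ← AddChar.map_add_eq_mul]
  congr 3
  rw [inner_sub_left]; ring_nf

lemma fourier_dd {n : ℕ} (hn : 1 ≤ n) {s : ℝ} (hs0 : 0 < s) (hs1 : s < 1)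
    {u : EuclideanSpace ℝ (Fin n) → ℝ} (hu : ContDiff ℝ (⊤ : ℕ∞) u)
    (hc : HasCompactSupport u) (i : Fin n) (ξ : EuclideanSpace ℝ (Fin n)) :
    𝓕 (fun x => (dd n s u i x : ℂ)) ξ = 𝓕 (fun x => (u x : ℂ)) ξ *
      ∫ z, (1 - (Real.fourierChar (-inner ℝ z ξ) : ℂ)) * (kk n s i z : ℂ) := by
  have hI := (dd_prod_int hn hs0 hs1 hu hc i).ofReal (𝕜 := ℂ)
  have hI2 : Integrable (Function.uncurry fun (x z : EuclideanSpace ℝ (Fin n)) =>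
      Real.fourierChar (-inner ℝ x ξ) • (((u x - u (x - z)) * kk n s i z : ℝ) : ℂ))
      (volume.prod volume) := by
    refine hI.mono ?_ (Eventually.of_forall fun q => by simp [Function.uncurry])
    exact (Real.continuous_fourierChar.comp (by fun_prop :
      Continuous fun q : EuclideanSpace ℝ (Fin n) × EuclideanSpace ℝ (Fin n) => -inner ℝ q.1 ξ)
      ).aestronglyMeasurable.smul hI.aestronglyMeasurable
  have hui : Integrable (fun x => (u x : ℂ)) := (u_int hu hc).ofReal
  calc 𝓕 (fun x => (dd n s u i x : ℂ)) ξ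
      = ∫ x, ∫ z, Real.fourierChar (-inner ℝ x ξ) •
        (((u x - u (x - z)) * kk n s i z : ℝ) : ℂ) := by
        rw [Real.fourier_eq]
        refine integral_congr_ae (Eventually.of_forall fun x => ?_)
        simp only [Circle.smul_def]
        rw [integral_smul, integral_complex_ofReal]
        rfl
    _ = ∫ z, ∫ x, Real.fourierChar (-inner ℝ x ξ) •
        (((u x - u (x - z)) * kk n s i z : ℝ) : ℂ) := integral_integral_swap hI2
    _ = ∫ z, 𝓕 (fun x => (u x : ℂ)) ξ *
          ((1 - (Real.fourierChar (-inner ℝ z ξ) : ℂ)) * (kk n s i z : ℂ)) := by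
        refine integral_congr_ae (Eventually.of_forall fun z => ?_)
        simp only
        have e : ∀ x : EuclideanSpace ℝ (Fin n), Real.fourierChar (-inner ℝ x ξ) •
            (((u x - u (x - z)) * kk n s i z : ℝ) : ℂ) =
            (Real.fourierChar (-inner ℝ x ξ) • (u x : ℂ) -
             Real.fourierChar (-inner ℝ x ξ) • (u (x - z) : ℂ)) * (kk n s i z : ℂ) := by
          intro x; simp only [Circle.smul_def, smul_eq_mul]; push_cast; ring
        simp_rw [e]
        rw [integral_mul_const, integral_sub ((Real.fourierIntegral_convergent_iff ξ).2 hui)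
          ((Real.fourierIntegral_convergent_iff ξ).2 (hui.comp_sub_right z)),
          fourier_shift (fun x => (u x : ℂ)) z ξ]
        have : ∫ x, Real.fourierChar (-inner ℝ x ξ) • (u x : ℂ) =
          𝓕 (fun x => (u x : ℂ)) ξ := (Real.fourier_eq _ _).symm
        rw [this]
        ring
    _ = _ := by rw [integral_const_mul]

/-! ### The representation identity -/

open FourierTransform

lemma cv_props {n : ℕ} {f g : EuclideanSpace ℝ (Fin n) → ℝ} (hf : Integrable f)
    (hg : Integrable g) (hgc : Continuous g) (hgb : ∃ C, ∀ x, |g x| ≤ C) :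
    Continuous (fun x => ∫ y, f y * g (x - y)) ∧
    Integrable (fun x => ∫ y, f y * g (x - y)) ∧
    ∀ ξ, 𝓕 (fun x => ((∫ y, f y * g (x - y) : ℝ) : ℂ)) ξ =
      𝓕 (fun x => (f x : ℂ)) ξ * 𝓕 (fun x => (g x : ℂ)) ξ := by
  obtain ⟨C, hC⟩ := hgb
  have hfc : Integrable (fun x => (f x : ℂ)) := hf.ofReal
  have hgc' : Integrable (fun x => (g x : ℂ)) := hg.ofReal
  refine ⟨?_, ?_, fun ξ => ?_⟩
  · exact BddAbove.continuous_convolution_right_of_integrable (ContinuousLinearMap.mul ℝ ℝ)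
      (f := f) (g := g) ⟨C, by rintro _ ⟨x, rfl⟩; exact hC x⟩ hf hgc
  · exact hf.integrable_convolution (ContinuousLinearMap.mul ℝ ℝ) hg
  · rw [← Real.fourier_mul_convolution_eq hfc hgc' ξ]
    refine congrArg (fun F : EuclideanSpace ℝ (Fin n) → ℂ => 𝓕 F ξ) (funext fun x => ?_)
    rw [← integral_complex_ofReal]
    simp [convolution, ContinuousLinearMap.mul_apply']

lemma eq_zero_of_fourier {n : ℕ} {f : EuclideanSpace ℝ (Fin n) → ℂ} (hc : Continuous f)
    (hf : Integrable f) (h : ∀ ξ, 𝓕 f ξ = 0) (x : EuclideanSpace ℝ (Fin n)) : f x = 0 := by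
  have h0 : 𝓕 f = 0 := by ext ξ; simpa using h ξ
  have := hc.fourierInv_fourier_eq hf (by rw [h0]; exact integrable_zero _ _ _)
  rw [← this, h0, Real.fourierInv_eq]
  simp

def BB (s : ℝ) : ℝ := Real.Gamma ((1 - s) / 2) * Real.Gamma ((s + 1) / 2) / Real.pi

lemma BB_pos {s : ℝ} (hs0 : 0 < s) (hs1 : s < 1) : 0 < BB s := by
  unfold BB
  have h1 := Real.Gamma_pos_of_pos (by linarith : 0 < (1 - s) / 2)
  have h2 := Real.Gamma_pos_of_pos (by linarith : 0 < (s + 1) / 2)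
  have := Real.pi_pos
  positivity

lemma symbol_prod {n : ℕ} {s ε : ℝ} (hs0 : 0 < s) (hs1 : s < 1)
    (hε : 0 < ε) (ξ : EuclideanSpace ℝ (Fin n)) :
    ‖ξ‖ ^ 2 * (∫ τ in Set.Ioi (0:ℝ), wE s ε τ * Real.exp (-(Real.pi * ‖ξ‖ ^ 2 * τ))) *
      (∫ t in Set.Ioi (0:ℝ), t ^ (-((s + 1) / 2)) * Real.exp (-(Real.pi * ‖ξ‖ ^ 2 * t))) =
    BB s * (1 - Real.exp (-(Real.pi * ε * ‖ξ‖ ^ 2))) := by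
  rcases eq_or_ne ξ 0 with rfl | hξ
  · simp
  have hx : 0 < ‖ξ‖ := norm_pos_iff.2 hξ
  have hπ := Real.pi_pos
  set r := Real.pi * ‖ξ‖ ^ 2 with hr
  have hr0 : 0 < r := by positivity
  rw [lap_wE hs0 hε hr0]
  have h := Real.integral_rpow_mul_exp_neg_mul_Ioi (a := (1 - s) / 2) (r := r) (by linarith) hr0
  rw [show (1 - s) / 2 - 1 = -((s + 1) / 2) by ring] at h
  rw [h]
  have e : (1 / r) ^ ((s + 1) / 2) * (1 / r) ^ ((1 - s) / 2) = 1 / r := by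
    rw [← Real.rpow_add (by positivity), show (s + 1) / 2 + (1 - s) / 2 = 1 by ring, Real.rpow_one]
  have e2 : ‖ξ‖ ^ 2 * (1 / r) = 1 / Real.pi := by rw [hr]; field_simp
  rw [show Real.pi * ε * ‖ξ‖ ^ 2 = r * ε by rw [hr]; ring]
  unfold BB
  calc _ = (‖ξ‖ ^ 2 * ((1 / r) ^ ((s + 1) / 2) * (1 / r) ^ ((1 - s) / 2))) *
      (Real.Gamma ((1 - s) / 2) * Real.Gamma ((s + 1) / 2)) * (1 - Real.exp (-(r * ε))) := by ring
    _ = _ := by rw [e, e2]; ring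

lemma fourier_lin {n : ℕ} {ι : Type*} [Fintype ι] (c : ι → EuclideanSpace ℝ (Fin n) → ℝ)
    (f g : EuclideanSpace ℝ (Fin n) → ℝ) (a b : ℝ) (hc : ∀ i, Integrable (c i))
    (hf : Integrable f) (hg : Integrable g) (ξ : EuclideanSpace ℝ (Fin n)) :
    𝓕 (fun x => ((a * ∑ i, c i x - b * (f x - g x) : ℝ) : ℂ)) ξ =
      a * ∑ i, 𝓕 (fun x => (c i x : ℂ)) ξ - b * (𝓕 (fun x => (f x : ℂ)) ξ -
        𝓕 (fun x => (g x : ℂ)) ξ) := by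
  have h1 : ∀ {h : EuclideanSpace ℝ (Fin n) → ℝ}, Integrable h → Integrable fun x =>
      (Real.fourierChar (-inner ℝ x ξ) : ℂ) * (h x : ℂ) := by
    intro h hh
    have h' : Integrable (fun x => (h x : ℂ)) := hh.ofReal
    have := (Real.fourierIntegral_convergent_iff ξ).2 h'
    simpa only [Circle.smul_def, smul_eq_mul] using this
  simp only [Real.fourier_eq, Circle.smul_def, smul_eq_mul]
  rw [← integral_finsetSum _ (fun i _ => h1 (hc i)), ← integral_sub (h1 hf) (h1 hg),
    ← integral_const_mul, ← integral_const_mul, ← integral_sub]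
  · refine integral_congr_ae (Eventually.of_forall fun x => ?_)
    simp only [← Finset.mul_sum]
    push_cast
    ring
  · exact (integrable_finsetSum _ (fun i _ => h1 (hc i))).const_mul _
  · exact ((h1 hf).sub (h1 hg)).const_mul _

lemma repr_identity {n : ℕ} (hn : 1 ≤ n) {s ε : ℝ} (hs0 : 0 < s) (hs1 : s < 1) (hε : 0 < ε)
    {u : EuclideanSpace ℝ (Fin n) → ℝ} (hu : ContDiff ℝ (⊤ : ℕ∞) u)
    (hc : HasCompactSupport u) (x : EuclideanSpace ℝ (Fin n)) :
    AA n s * ∑ i, ∫ y, KK n s ε i y * dd n s u i (x - y) =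
      BB s * (u x - ∫ y, gK n ε y * u (x - y)) := by
  have hui := u_int hu hc
  have hub : ∃ C, ∀ x, |u x| ≤ C := hc.exists_bound_of_continuous hu.continuous
  have H1 : ∀ i, _ := fun i => cv_props (KK_integrable hn hs0 hs1 i hε)
    (dd_int hn hs0 hs1 hu hc i) (dd_cont hn hs0 hs1 hu hc i).1 (dd_cont hn hs0 hs1 hu hc i).2
  have H2 := cv_props (integrable_gK n hε) hui hu.continuous hub
  have key := eq_zero_of_fourier (f := fun x => ((AA n s * ∑ i, (∫ y, KK n s ε i y *
    dd n s u i (x - y)) - BB s * (u x - ∫ y, gK n ε y * u (x - y)) : ℝ) : ℂ)) ?_ ?_ ?_ x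
  · have := Complex.ofReal_eq_zero.1 key
    linarith
  · refine Complex.continuous_ofReal.comp ?_
    refine (continuous_const.mul (continuous_finsetSum _ fun i _ => (H1 i).1)).sub
      (continuous_const.mul (hu.continuous.sub H2.1))
  · refine Integrable.ofReal ?_
    exact ((integrable_finsetSum _ (fun i _ => (H1 i).2.1)).const_mul _).sub
      ((hui.sub H2.2.1).const_mul _)
  · intro ξ
    rw [fourier_lin (fun i x => ∫ y, KK n s ε i y * dd n s u i (x - y)) u _ _ _
      (fun i => (H1 i).2.1) hui H2.2.1, H2.2.2, fourier_gK n hε]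
    simp_rw [(H1 _).2.2, fourier_KK hn hs0 hs1 _ hε, fourier_dd hn hs0 hs1 hu hc]
    have hsym := symbol_prod (n := n) hs0 hs1 hε ξ
    set W := (∫ τ in Set.Ioi (0:ℝ), wE s ε τ * Real.exp (-(Real.pi * ‖ξ‖ ^ 2 * τ)))
    set T := (∫ t in Set.Ioi (0:ℝ), t ^ (-((s + 1) / 2)) *
      Real.exp (-(Real.pi * ‖ξ‖ ^ 2 * t))) with hT
    set U := 𝓕 (fun x => (u x : ℂ)) ξ
    have hm := fun i => symbol_kk hn hs0 hs1 i ξ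
    rw [← hT] at hm
    have e : (AA n s : ℂ) * ∑ i, -Complex.I * (ξ i : ℂ) * (W : ℂ) *
        (U * ∫ z, (1 - (Real.fourierChar (-inner ℝ z ξ) : ℂ)) * (kk n s i z : ℂ)) =
        U * ((‖ξ‖ ^ 2 * W * T : ℝ) : ℂ) := by
      rw [EuclideanSpace.real_norm_sq_eq, Finset.mul_sum]
      push_cast
      rw [Finset.sum_mul, Finset.sum_mul, Finset.mul_sum]
      refine Finset.sum_congr rfl fun i _ => ?_
      calc _ = -Complex.I * (ξ i : ℂ) * (W : ℂ) * U * ((AA n s : ℂ) *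
          ∫ z, (1 - (Real.fourierChar (-inner ℝ z ξ) : ℂ)) * (kk n s i z : ℂ)) := by ring
        _ = -(Complex.I * Complex.I) * ((ξ i : ℂ) ^ 2 * W * T * U) := by rw [hm]; ring
        _ = _ := by rw [Complex.I_mul_I]; ring
    rw [e, hsym]
    push_cast
    ring

/-! ### Pointwise estimate by the fractional gradient -/

lemma cns_pos {n : ℕ} (hn : 1 ≤ n) {s : ℝ} (hs0 : 0 < s) (hs1 : s < 1) : 0 < cns n s := by
  have hn' : (1:ℝ) ≤ n := by exact_mod_cast hn
  have h1 : 0 < (n : ℝ) + s - 1 := by linarith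
  have h2 := Real.Gamma_pos_of_pos (by linarith : 0 < (1 - s) / 2)
  have h3 := Real.Gamma_pos_of_pos (by linarith : 0 < ((n : ℝ) + s - 1) / 2)
  unfold cns
  have := Real.pi_pos
  positivity

lemma rieszGrad_apply {n : ℕ} (hn : 1 ≤ n) {s : ℝ} (hs0 : 0 < s) (hs1 : s < 1)
    {u : EuclideanSpace ℝ (Fin n) → ℝ} (hu : ContDiff ℝ (⊤ : ℕ∞) u)
    (hc : HasCompactSupport u) (x : EuclideanSpace ℝ (Fin n)) (i : Fin n) :
    rieszGrad n s u x i = cns n s * dd n s u i x := by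
  have e : ∀ (i : Fin n) (y : EuclideanSpace ℝ (Fin n)),
      (((u x - u y) / ‖x - y‖ ^ ((n : ℝ) + s + 1)) • (x - y)) i =
      (fun z => (u x - u (x - z)) * kk n s i z) (x - y) := by
    intro i y
    simp only [PiLp.smul_apply, smul_eq_mul, sub_sub_cancel, kk]
    rw [Real.rpow_neg (norm_nonneg _)]
    ring
  have hi : ∀ i : Fin n, Integrable (fun y =>
      (((u x - u y) / ‖x - y‖ ^ ((n : ℝ) + s + 1)) • (x - y)) i) := by
    intro i
    simp_rw [e]
    exact (dd_integrand_int hn hs0 hs1 hu hc i x).comp_sub_left x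
  unfold rieszGrad
  rw [PiLp.smul_apply, eval_integral_piLp hi, smul_eq_mul]
  simp_rw [e]
  rw [integral_sub_left_eq_self (fun z => (u x - u (x - z)) * kk n s i z) volume x]
  rfl

lemma rieszGrad_cont {n : ℕ} (hn : 1 ≤ n) {s : ℝ} (hs0 : 0 < s) (hs1 : s < 1)
    {u : EuclideanSpace ℝ (Fin n) → ℝ} (hu : ContDiff ℝ (⊤ : ℕ∞) u)
    (hc : HasCompactSupport u) : Continuous (rieszGrad n s u) := by
  have : rieszGrad n s u = fun x => WithLp.toLp 2 (fun i => cns n s * dd n s u i x) := by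
    ext x i
    exact rieszGrad_apply hn hs0 hs1 hu hc x i
  rw [this]
  refine (PiLp.continuous_toLp 2 _).comp (continuous_pi fun i => ?_)
  exact continuous_const.mul (dd_cont hn hs0 hs1 hu hc i).1

lemma dd_le {n : ℕ} (hn : 1 ≤ n) {s : ℝ} (hs0 : 0 < s) (hs1 : s < 1)
    {u : EuclideanSpace ℝ (Fin n) → ℝ} (hu : ContDiff ℝ (⊤ : ℕ∞) u)
    (hc : HasCompactSupport u) (x : EuclideanSpace ℝ (Fin n)) (i : Fin n) :
    |dd n s u i x| ≤ (cns n s)⁻¹ * ‖rieszGrad n s u x‖ := by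
  have hp := cns_pos hn hs0 hs1
  have h := abs_coord_le (rieszGrad n s u x) i
  rw [rieszGrad_apply hn hs0 hs1 hu hc, abs_mul, abs_of_pos hp] at h
  rw [inv_mul_eq_div, le_div_iff₀ hp]
  linarith

def MM (n : ℕ) (s : ℝ) : ℝ := AA n s / BB s * n * (cns n s)⁻¹

lemma pointwise_bound {n : ℕ} (hn : 1 ≤ n) {s α β ε : ℝ} (hs0 : 0 < s) (hs1 : s < 1)
    (hα : -1 < α) (hα1 : n - s < α) (hα2 : α < n - s + 2)
    (hβ : -1 < β) (hβ1 : n - s < β) (hβ2 : β < n - s + 2) (hε : 0 < ε)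
    {u : EuclideanSpace ℝ (Fin n) → ℝ} (hu : ContDiff ℝ (⊤ : ℕ∞) u)
    (hc : HasCompactSupport u) (x : EuclideanSpace ℝ (Fin n)) :
    ‖u x - ∫ y, gK n ε y * u (x - y)‖ₑ ≤ ENNReal.ofReal (MM n s * om n s α β ε) *
      ∫⁻ y, ENNReal.ofReal (prof n α β y) * ‖rieszGrad n s u (x - y)‖ₑ := by
  have hB := BB_pos hs0 hs1
  have hA := AA_pos n hs0
  have hp := cns_pos hn hs0 hs1
  have h1 : u x - ∫ y, gK n ε y * u (x - y) =
      AA n s / BB s * ∑ i, ∫ y, KK n s ε i y * dd n s u i (x - y) := by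
    have := repr_identity hn hs0 hs1 hε hu hc x
    field_simp
    linarith
  have hom : 0 ≤ om n s α β ε := by
    have hn' : (0:ℝ) ≤ n := by positivity
    have hJ : ∀ b, 0 ≤ JJ s b := fun b =>
      setIntegral_nonneg measurableSet_Ioi fun t ht => by
        have : (0:ℝ) < t := ht
        positivity
    have := hJ ((α - n - 1) / 2)
    have := hJ ((β - n - 1) / 2)
    have := CK_nonneg hα
    have := CK_nonneg hβ
    unfold om
    positivity
  have hcm : Measurable fun y => ENNReal.ofReal (prof n α β y) * ‖rieszGrad n s u (x - y)‖ₑ := by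
    have := (rieszGrad_cont hn hs0 hs1 hu hc).measurable
    have h2 : Measurable (prof n α β) := by unfold prof; fun_prop
    fun_prop
  have h2 : ∀ i, ‖∫ y, KK n s ε i y * dd n s u i (x - y)‖ₑ ≤
      ENNReal.ofReal (om n s α β ε * (cns n s)⁻¹) *
      ∫⁻ y, ENNReal.ofReal (prof n α β y) * ‖rieszGrad n s u (x - y)‖ₑ := by
    intro i
    refine (enorm_integral_le_lintegral_enorm _).trans ?_
    rw [← lintegral_const_mul _ hcm]
    refine lintegral_mono fun y => ?_
    have b1 := KK_bound hs0 hs1 i hα hα1 hα2 hβ hβ1 hβ2 hε y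
    have b2 := dd_le hn hs0 hs1 hu hc (x - y) i
    have hpr := prof_nonneg n α β y
    rw [Real.enorm_eq_ofReal_abs, ← ofReal_norm, ← ENNReal.ofReal_mul hpr,
      ← ENNReal.ofReal_mul (by positivity), abs_mul]
    refine ENNReal.ofReal_le_ofReal ?_
    calc _ ≤ (om n s α β ε * prof n α β y) * ((cns n s)⁻¹ * ‖rieszGrad n s u (x - y)‖) :=
          mul_le_mul b1 b2 (abs_nonneg _) (by positivity)
      _ = _ := by ring
  rw [h1, enorm_mul]
  calc _ ≤ ‖AA n s / BB s‖ₑ * ∑ i : Fin n, (ENNReal.ofReal (om n s α β ε * (cns n s)⁻¹) *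
      ∫⁻ y, ENNReal.ofReal (prof n α β y) * ‖rieszGrad n s u (x - y)‖ₑ) := by
        gcongr
        exact (enorm_sum_le _ _).trans (Finset.sum_le_sum fun i _ => h2 i)
    _ = _ := by
        rw [Finset.sum_const, Finset.card_univ, Fintype.card_fin, nsmul_eq_mul,
          Real.enorm_of_nonneg (by positivity), ← mul_assoc, ← mul_assoc]
        congr 1
        rw [← ENNReal.ofReal_natCast, ← ENNReal.ofReal_mul (by positivity),
          ← ENNReal.ofReal_mul (by positivity)]
        congr 1
        unfold MM
        ring

/-! ### Young's convolution inequality -/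

lemma young_aux {n : ℕ} {p q r : ℝ} (hp : 1 ≤ p) (hr : 1 ≤ r) (hpq : p ≤ q) (hrq : r ≤ q)
    (h : 1 / r + 1 / p = 1 + 1 / q) {f g : EuclideanSpace ℝ (Fin n) → ENNReal}
    (hf : Measurable f) (hg : Measurable g) :
    ∫⁻ x, (∫⁻ y, f y * g (x - y)) ^ q ≤
      (∫⁻ y, f y ^ r) ^ (q / r) * (∫⁻ y, g y ^ p) ^ (q / p) := by
  have hq0 : 0 < q := by linarith
  have hr0 : 0 < r := by linarith
  have hp0 : 0 < p := by linarith
  have e1 : 0 ≤ 1 / q := by positivity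
  have e2 : 0 ≤ 1 / r - 1 / q := sub_nonneg.2 (one_div_le_one_div_of_le hr0 hrq)
  have e3 : 0 ≤ 1 / p - 1 / q := sub_nonneg.2 (one_div_le_one_div_of_le hp0 hpq)
  set A := ∫⁻ y, f y ^ r
  set B := ∫⁻ y, g y ^ p
  have hsplit : ∀ (a : ENNReal) (t : ℝ), 0 < t → 0 ≤ 1 / t - 1 / q →
      a = (a ^ t) ^ (1 / q) * (a ^ t) ^ (1 / t - 1 / q) := by
    intro a t ht h0
    rw [← ENNReal.rpow_add_of_nonneg _ _ e1 h0, ← ENNReal.rpow_mul,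
      show t * (1 / q + (1 / t - 1 / q)) = 1 by field_simp; ring, ENNReal.rpow_one]
  have pt : ∀ x, ∫⁻ y, f y * g (x - y) ≤ (∫⁻ y, f y ^ r * g (x - y) ^ p) ^ (1 / q) *
      A ^ (1 / r - 1 / q) * B ^ (1 / p - 1 / q) := by
    intro x
    have := ENNReal.lintegral_prod_norm_pow_le (μ := (volume : Measure (EuclideanSpace ℝ (Fin n))))
      (Finset.univ : Finset (Fin 3))
      (f := ![fun y => f y ^ r * g (x - y) ^ p, fun y => f y ^ r, fun y => g (x - y) ^ p])
      (p := ![1 / q, 1 / r - 1 / q, 1 / p - 1 / q])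
      (by
        intro i _
        refine Measurable.aemeasurable ?_
        fin_cases i
        · change Measurable fun y => f y ^ r * g (x - y) ^ p
          fun_prop
        · change Measurable fun y => f y ^ r
          fun_prop
        · change Measurable fun y => g (x - y) ^ p
          fun_prop)
      (by simp [Fin.sum_univ_three]; simp at h; linarith)
      (by intro i _; fin_cases i <;> assumption)
    simp only [Fin.prod_univ_three, Matrix.cons_val_zero, Matrix.cons_val_one,
      Matrix.cons_val] at this
    rw [lintegral_sub_left_eq_self (fun y => g y ^ p) x] at this
    refine le_trans (le_of_eq ?_) this
    refine lintegral_congr fun y => ?_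
    rw [ENNReal.mul_rpow_of_nonneg _ _ e1]
    nth_rw 1 [hsplit (f y) r hr0 e2, hsplit (g (x - y)) p hp0 e3]
    ring
  have pt2 : ∀ x, (∫⁻ y, f y * g (x - y)) ^ q ≤ (∫⁻ y, f y ^ r * g (x - y) ^ p) *
      (A ^ (q / r - 1) * B ^ (q / p - 1)) := by
    intro x
    refine (ENNReal.rpow_le_rpow (pt x) hq0.le).trans (le_of_eq ?_)
    rw [ENNReal.mul_rpow_of_nonneg _ _ hq0.le, ENNReal.mul_rpow_of_nonneg _ _ hq0.le,
      ← ENNReal.rpow_mul, ← ENNReal.rpow_mul, ← ENNReal.rpow_mul, mul_assoc]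
    congr 2
    · rw [show 1 / q * q = 1 by field_simp, ENNReal.rpow_one]
    · congr 1; field_simp
    · congr 1; field_simp
  have hm : Measurable fun z : EuclideanSpace ℝ (Fin n) × EuclideanSpace ℝ (Fin n) =>
      f z.2 ^ r * g (z.1 - z.2) ^ p := by fun_prop
  refine (lintegral_mono pt2).trans (le_of_eq ?_)
  rw [lintegral_mul_const _ hm.lintegral_prod_right']
  have hF : ∫⁻ x, ∫⁻ y, f y ^ r * g (x - y) ^ p = A * B := by
    rw [lintegral_lintegral_swap hm.aemeasurable]
    have : ∀ y, ∫⁻ x, f y ^ r * g (x - y) ^ p = f y ^ r * B := by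
      intro y
      rw [lintegral_const_mul _ (by fun_prop), lintegral_sub_right_eq_self (fun x => g x ^ p) y]
    simp_rw [this]
    rw [lintegral_mul_const _ (by fun_prop)]
  rw [hF]
  have eA : A * A ^ (q / r - 1) = A ^ (q / r) := by
    nth_rw 1 [← ENNReal.rpow_one A]
    rw [← ENNReal.rpow_add_of_nonneg _ _ zero_le_one
      (by rw [sub_nonneg, le_div_iff₀ hr0]; linarith), add_sub_cancel]
  have eB : B * B ^ (q / p - 1) = B ^ (q / p) := by
    nth_rw 1 [← ENNReal.rpow_one B]
    rw [← ENNReal.rpow_add_of_nonneg _ _ zero_le_one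
      (by rw [sub_nonneg, le_div_iff₀ hp0]; linarith), add_sub_cancel]
  rw [← eA, ← eB]
  ring

lemma prof_pow {n : ℕ} {α β r : ℝ} (hr : 0 < r) (y : EuclideanSpace ℝ (Fin n)) :
    prof n α β y ^ r = min (‖y‖ ^ (-(α * r))) (‖y‖ ^ (-(β * r))) := by
  unfold prof
  rw [← neg_mul, ← neg_mul, Real.rpow_mul (norm_nonneg _), Real.rpow_mul (norm_nonneg _)]
  rcases le_total (‖y‖ ^ (-α)) (‖y‖ ^ (-β)) with h | h
  · rw [min_eq_left h, min_eq_left (Real.rpow_le_rpow (by positivity) h hr.le)]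
  · rw [min_eq_right h, min_eq_right (Real.rpow_le_rpow (by positivity) h hr.le)]

lemma lq_bound {n : ℕ} (hn : 1 ≤ n) {s p q : ℝ} (hs0 : 0 < s) (hs1 : s < 1)
    (hp : 1 ≤ p) (hsp : s * p < n) (hpq : p ≤ q) (hq' : q < n * p / (n - s * p)) :
    ∃ ω : ℝ → ENNReal, Tendsto ω (nhdsWithin 0 (Set.Ioi 0)) (nhds 0) ∧
      ∀ ε, 0 < ε → ∀ u : EuclideanSpace ℝ (Fin n) → ℝ, ContDiff ℝ (⊤ : ℕ∞) u →
        HasCompactSupport u →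
        eLpNorm (fun x => u x - ∫ y, gK n ε y * u (x - y)) (ENNReal.ofReal q) volume ≤
          ω ε * eLpNorm (rieszGrad n s u) (ENNReal.ofReal p) volume := by
  have hn' : (1:ℝ) ≤ n := by exact_mod_cast hn
  have hn0 : (0:ℝ) < n := by linarith
  have hp0 : 0 < p := by linarith
  have hq0 : 0 < q := by linarith
  set ρ := 1 + 1 / q - 1 / p with hρ
  have hρ1 : ρ ≤ 1 := by
    have := one_div_le_one_div_of_le hp0 hpq
    linarith
  have hρq : 1 / q ≤ ρ := by
    have : 1 / p ≤ 1 := by rw [div_le_one hp0]; exact hp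
    linarith
  have hρ0 : 0 < ρ := lt_of_lt_of_le (by positivity) hρq
  have hρs : n - s < n * ρ := by
    have h1 : q * (n - s * p) < n * p := by rwa [lt_div_iff₀ (by linarith)] at hq'
    have h2 : n * ρ - (n - s) = (n * p - q * (n - s * p)) / (p * q) := by
      rw [hρ]; field_simp; ring
    have h3 : 0 < (n * p - q * (n - s * p)) / (p * q) := div_pos (by linarith) (by positivity)
    linarith
  set r := 1 / ρ with hr
  have hr1 : 1 ≤ r := by rw [hr, le_div_iff₀ hρ0]; linarith
  have hrq : r ≤ q := by
    rw [hr, div_le_iff₀ hρ0]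
    rw [div_le_iff₀ hq0] at hρq
    linarith
  have hsum : 1 / r + 1 / p = 1 + 1 / q := by rw [hr, one_div_one_div, hρ]; ring
  set α := (n - s + n * ρ) / 2 with hα
  set β := (n : ℝ) + 1 - s with hβ
  have hnρ : n * ρ ≤ n := by nlinarith
  have a1 : -1 < α := by rw [hα]; linarith
  have a2 : n - s < α := by rw [hα]; linarith
  have a3 : α < n - s + 2 := by rw [hα]; linarith
  have a4 : α * r < n := by
    rw [hr, mul_one_div, div_lt_iff₀ hρ0, hα]; linarith
  have b4 : n < β * r := by rw [hβ]; nlinarith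
  have hI : Integrable (fun y => prof n α β y ^ r) := by
    simp_rw [prof_pow (n := n) (α := α) (β := β) (lt_of_lt_of_le one_pos hr1)]
    exact int_min_norm hn a4 b4
  have hpm : Measurable (prof n α β) := by unfold prof; fun_prop
  set A := ∫⁻ y, ENNReal.ofReal (prof n α β y) ^ r with hA
  have hAt : A ≠ ⊤ := by
    have : A = ∫⁻ y, ENNReal.ofReal (prof n α β y ^ r) := by
      rw [hA]
      refine lintegral_congr fun y => ?_
      rw [ENNReal.ofReal_rpow_of_nonneg (prof_nonneg _ _ _ _) (by linarith)]
    rw [this]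
    exact (hI.lintegral_lt_top).ne
  refine ⟨fun ε => ENNReal.ofReal (MM n s * om n s α β ε) * A ^ (1 / r), ?_, ?_⟩
  · have h1 : Tendsto (fun ε => MM n s * om n s α β ε) (nhdsWithin 0 (Set.Ioi 0)) (nhds 0) := by
      simpa using (om_tendsto (n := n) (s := s) (α := α) (β := β) a2
        (by rw [hβ]; linarith)).const_mul (MM n s)
    have h2 := ENNReal.tendsto_ofReal h1
    rw [ENNReal.ofReal_zero] at h2
    have h3 := ENNReal.Tendsto.mul_const (b := A ^ (1 / r)) h2
      (Or.inr (ENNReal.rpow_ne_top_of_nonneg (by positivity) hAt))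
    simpa using h3
  · intro ε hε u hu hc
    have hgm : Measurable fun y => ‖rieszGrad n s u y‖ₑ :=
      (rieszGrad_cont hn hs0 hs1 hu hc).measurable.enorm
    have hY := young_aux hp hr1 hpq hrq hsum (f := fun y => ENNReal.ofReal (prof n α β y))
      (g := fun y => ‖rieszGrad n s u y‖ₑ) (by fun_prop) hgm
    rw [eLpNorm_eq_lintegral_rpow_enorm_toReal (by simpa using hq0) (by simp),
      eLpNorm_eq_lintegral_rpow_enorm_toReal (by simpa using hp0) (by simp),
      ENNReal.toReal_ofReal hq0.le, ENNReal.toReal_ofReal hp0.le]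
    set B := ∫⁻ y, ‖rieszGrad n s u y‖ₑ ^ p
    set c := ENNReal.ofReal (MM n s * om n s α β ε)
    have h1 : ∫⁻ x, ‖u x - ∫ y, gK n ε y * u (x - y)‖ₑ ^ q ≤
        c ^ q * (A ^ (q / r) * B ^ (q / p)) := by
      calc _ ≤ ∫⁻ x, c ^ q * (∫⁻ y, ENNReal.ofReal (prof n α β y) *
          ‖rieszGrad n s u (x - y)‖ₑ) ^ q := by
            refine lintegral_mono fun x => ?_
            rw [← ENNReal.mul_rpow_of_nonneg _ _ hq0.le]
            exact ENNReal.rpow_le_rpow (pointwise_bound hn hs0 hs1 a1 a2 a3 (by rw [hβ]; linarith)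
              (by rw [hβ]; linarith) (by rw [hβ]; linarith) hε hu hc x) hq0.le
        _ = c ^ q * ∫⁻ x, (∫⁻ y, ENNReal.ofReal (prof n α β y) *
          ‖rieszGrad n s u (x - y)‖ₑ) ^ q := lintegral_const_mul' _ _
            (ENNReal.rpow_ne_top_of_nonneg hq0.le ENNReal.ofReal_ne_top)
        _ ≤ _ := by gcongr
    refine (ENNReal.rpow_le_rpow h1 (by positivity : 0 ≤ 1 / q)).trans (le_of_eq ?_)
    rw [ENNReal.mul_rpow_of_nonneg _ _ (by positivity),
      ENNReal.mul_rpow_of_nonneg _ _ (by positivity),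
      ← ENNReal.rpow_mul, ← ENNReal.rpow_mul, ← ENNReal.rpow_mul, ← mul_assoc]
    rw [show q * (1 / q) = 1 by field_simp, ENNReal.rpow_one,
      show q / r * (1 / q) = 1 / r by field_simp, show q / p * (1 / q) = 1 / p by field_simp]

/-! ### Compactness of the regularised sequence -/

lemma cheap_holder {n : ℕ} {h u : EuclideanSpace ℝ (Fin n) → ℝ} {p b : ℝ} (hp : 1 ≤ p)
    (hh : Integrable h) (hb : ∀ y, |h y| ≤ b)
    (hup : Integrable (fun y => |u y| ^ p)) :
    |∫ y, h y * u y| ≤ (∫ y, |h y|) + b * ∫ y, |u y| ^ p := by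
  by_cases hig : Integrable (fun y => h y * u y)
  · rw [← integral_const_mul, ← integral_add hh.abs (hup.const_mul b)]
    refine abs_integral_le_integral_abs.trans ?_
    refine integral_mono hig.abs (hh.abs.add (hup.const_mul b)) fun y => ?_
    simp only [abs_mul]
    have h0 := abs_nonneg (h y)
    have hu0 := abs_nonneg (u y)
    have hpow : 0 ≤ |u y| ^ p := by positivity
    have h1 : |u y| ≤ 1 + |u y| ^ p := by
      rcases le_total (|u y|) 1 with h | h
      · linarith
      · have := Real.rpow_le_rpow_of_exponent_le h hp
        rw [Real.rpow_one] at this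
        linarith
    have := hb y
    calc |h y| * |u y| ≤ |h y| * (1 + |u y| ^ p) := by gcongr
      _ = |h y| + |h y| * |u y| ^ p := by ring
      _ ≤ |h y| + b * |u y| ^ p := by gcongr
  · rw [integral_undef hig, abs_zero]
    have hb0 : 0 ≤ b := (abs_nonneg _).trans (hb 0)
    have h1 : 0 ≤ ∫ y, |h y| := integral_nonneg fun y => abs_nonneg _
    have h2 : 0 ≤ ∫ y, |u y| ^ p := integral_nonneg fun y => by positivity
    positivity

lemma gK_le_const (n : ℕ) {t : ℝ} (ht : 0 < t) (y : EuclideanSpace ℝ (Fin n)) :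
    gK n t y ≤ t ^ (-((n : ℝ) / 2)) := by
  unfold gK
  have : Real.exp (-(Real.pi * ‖y‖ ^ 2 / t)) ≤ 1 := by
    rw [Real.exp_le_one_iff, neg_nonpos]
    have := Real.pi_pos
    positivity
  exact mul_le_of_le_one_right (by positivity) this

lemma gK_near (n : ℕ) {t : ℝ} (ht : 0 < t) (x z y : EuclideanSpace ℝ (Fin n))
    (hxz : ‖x - z‖ ≤ 1) :
    gK n t (x - y) ≤ Real.exp (Real.pi / t) * (2:ℝ) ^ ((n : ℝ) / 2) * gK n (2 * t) (z - y) := by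
  have hπ := Real.pi_pos
  have h1 : ‖z - y‖ ≤ ‖x - y‖ + 1 := by
    have := norm_sub_le (x - y) (x - z)
    rw [sub_sub_sub_cancel_left] at this
    linarith
  have h2 : ‖z - y‖ ^ 2 / 2 ≤ ‖x - y‖ ^ 2 + 1 := by
    have := pow_le_pow_left₀ (norm_nonneg _) h1 2
    nlinarith [sq_nonneg (‖x - y‖ - 1)]
  unfold gK
  rw [Real.mul_rpow (by norm_num) ht.le]
  have e1 : (2:ℝ) ^ ((n : ℝ) / 2) * (2:ℝ) ^ (-((n : ℝ) / 2)) = 1 := by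
    rw [← Real.rpow_add (by norm_num)]; simp
  calc t ^ (-((n : ℝ) / 2)) * Real.exp (-(Real.pi * ‖x - y‖ ^ 2 / t))
      ≤ t ^ (-((n : ℝ) / 2)) * (Real.exp (Real.pi / t) *
        Real.exp (-(Real.pi * ‖z - y‖ ^ 2 / (2 * t)))) := by
        rw [← Real.exp_add]
        gcongr
        have : Real.pi / t * (‖z - y‖ ^ 2 / 2) ≤ Real.pi / t * (‖x - y‖ ^ 2 + 1) := by gcongr
        have e2 : Real.pi / t * (‖z - y‖ ^ 2 / 2) = Real.pi * ‖z - y‖ ^ 2 / (2 * t) := by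
          field_simp
        have e3 : Real.pi / t * (‖x - y‖ ^ 2 + 1) = Real.pi * ‖x - y‖ ^ 2 / t + Real.pi / t := by
          field_simp
        linarith
    _ = ((2:ℝ) ^ ((n : ℝ) / 2) * (2:ℝ) ^ (-((n : ℝ) / 2))) * (t ^ (-((n : ℝ) / 2)) *
        (Real.exp (Real.pi / t) * Real.exp (-(Real.pi * ‖z - y‖ ^ 2 / (2 * t))))) := by
        rw [e1, one_mul]
    _ = _ := by ring

lemma gK_L1_cont (n : ℕ) {t : ℝ} (ht : 0 < t) (z : EuclideanSpace ℝ (Fin n)) :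
    Tendsto (fun x => ∫ y, |gK n t (x - y) - gK n t (z - y)|) (nhds z) (nhds 0) := by
  have hc := continuous_gK n t
  have h2t : 0 < 2 * t := by linarith
  have hi2 := (integrable_gK n h2t).comp_sub_left z
  have hi1 := (integrable_gK n ht).comp_sub_left z
  have := tendsto_integral_filter_of_dominated_convergence (l := nhds z)
    (μ := (volume : Measure (EuclideanSpace ℝ (Fin n))))
    (F := fun x y => |gK n t (x - y) - gK n t (z - y)|) (f := fun _ => (0:ℝ))
    (fun y => Real.exp (Real.pi / t) * (2:ℝ) ^ ((n : ℝ) / 2) * gK n (2 * t) (z - y) +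
      gK n t (z - y)) ?_ ?_ ?_ ?_
  · simpa using this
  · exact Eventually.of_forall fun x => (by fun_prop : Continuous _).aestronglyMeasurable
  · filter_upwards [Metric.ball_mem_nhds z one_pos] with x hx
    refine Eventually.of_forall fun y => ?_
    rw [Metric.mem_ball, dist_eq_norm] at hx
    have h1 := gK_near n ht x z y hx.le
    have h3 := (gK_pos n ht (x - y)).le
    have h4 := (gK_pos n ht (z - y)).le
    rw [Real.norm_eq_abs, abs_abs, abs_le]
    constructor <;> linarith
  · exact (hi2.const_mul _).add hi1
  · refine Eventually.of_forall fun y => ?_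
    have : Continuous fun x => |gK n t (x - y) - gK n t (z - y)| := by fun_prop
    simpa using this.tendsto z

lemma gK_unif (n : ℕ) {t : ℝ} (ht : 0 < t) : UniformContinuous (gK n t) := by
  refine (continuous_gK n t).uniformContinuous_of_tendsto_cocompact (x := 0) ?_
  have hπ := Real.pi_pos
  unfold gK
  have h1 : Tendsto (fun y : EuclideanSpace ℝ (Fin n) => Real.pi * ‖y‖ ^ 2 / t)
      (cocompact _) atTop := by
    have := (tendsto_pow_atTop (two_ne_zero)).comp
      (tendsto_norm_cocompact_atTop (E := EuclideanSpace ℝ (Fin n)))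
    exact (this.const_mul_atTop hπ).atTop_div_const ht
  have h2 := (Real.tendsto_exp_neg_atTop_nhds_zero.comp h1).const_mul (t ^ (-((n : ℝ) / 2)))
  simpa using h2

lemma net_exists {n : ℕ} {p ε Mp : ℝ} (hp : 1 ≤ p) (hε : 0 < ε)
    (K : Set (EuclideanSpace ℝ (Fin n))) (hK : IsCompact K)
    (u : ℕ → EuclideanSpace ℝ (Fin n) → ℝ) (huc : ∀ k, Continuous (u k))
    (hui : ∀ k, Integrable (u k))
    (hup : ∀ k, Integrable (fun y => |u k y| ^ p)) (hM : ∀ k, ∫ y, |u k y| ^ p ≤ Mp)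
    {δ : ℝ} (hδ : 0 < δ) :
    ∃ T : Set ℕ, T.Finite ∧ ∀ k, ∃ j ∈ T, ∀ x ∈ K,
      |(∫ y, gK n ε y * u k (x - y)) - ∫ y, gK n ε y * u j (x - y)| ≤ δ := by
  have hMp : 0 ≤ Mp := (integral_nonneg fun y => by positivity).trans (hM 0)
  set b := ε ^ (-((n : ℝ) / 2)) with hb
  have hb0 : 0 < b := by positivity
  have hg : ∀ x y : EuclideanSpace ℝ (Fin n), |gK n ε (x - y)| ≤ b := fun x y => by
    rw [abs_of_pos (gK_pos n hε _)]; exact gK_le_const n hε _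
  set v : ℕ → EuclideanSpace ℝ (Fin n) → ℝ := fun k x => ∫ y, gK n ε (x - y) * u k y with hv
  have hvx : ∀ k x, ∫ y, gK n ε y * u k (x - y) = v k x := by
    intro k x
    rw [hv, ← integral_sub_left_eq_self (fun y => gK n ε y * u k (x - y)) volume x]
    simp only [sub_sub_cancel]
  have hgi : ∀ x, Integrable (fun y => gK n ε (x - y)) := fun x =>
    (integrable_gK n hε).comp_sub_left x
  have hgu : ∀ k x, Integrable (fun y => gK n ε (x - y) * u k y) := fun k x =>
    (hui k).bdd_mul (c := b) (by
      have := continuous_gK n ε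
      exact (by fun_prop : Continuous _).aestronglyMeasurable)
      (Eventually.of_forall fun y => hg x y)
  -- equicontinuity modulus
  have hdiff : ∀ k x z η, (∀ y, |gK n ε (x - y) - gK n ε (z - y)| ≤ η) → 0 ≤ η →
      |v k x - v k z| ≤ (∫ y, |gK n ε (x - y) - gK n ε (z - y)|) + η * Mp := by
    intro k x z η hη hη0
    have e : v k x - v k z = ∫ y, (gK n ε (x - y) - gK n ε (z - y)) * u k y := by
      rw [hv]; simp only
      rw [← integral_sub (hgu k x) (hgu k z)]
      simp only [sub_mul]
    rw [e]
    refine (cheap_holder hp ((hgi x).sub (hgi z)) hη (hup k)).trans ?_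
    exact add_le_add le_rfl (mul_le_mul_of_nonneg_left (hM k) hη0)
  have hmod : ∀ z, ∀ r > 0, ∀ᶠ x in nhds z, ∀ k, |v k x - v k z| < r := by
    intro z r hr
    have h1 := (gK_L1_cont n hε z).eventually (gt_mem_nhds (half_pos hr))
    set η := r / (4 * (Mp + 1)) with hη
    have hη0 : 0 < η := by positivity
    obtain ⟨d, hd, hd2⟩ := Metric.uniformContinuous_iff.1 (gK_unif n hε) η hη0
    filter_upwards [h1, Metric.ball_mem_nhds z hd] with x hx1 hx2 k
    have := hdiff k x z η (fun y => by
      have := hd2 (a := x - y) (b := z - y) (by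
        rw [dist_sub_right]; exact hx2)
      rw [Real.dist_eq] at this
      exact this.le) hη0.le
    have h3 : η * Mp ≤ r / 4 := by
      have : η * (Mp + 1) = r / 4 := by rw [hη]; field_simp
      nlinarith
    linarith
  have hcont : ∀ k, Continuous (v k) := by
    intro k
    rw [continuous_iff_continuousAt]
    intro z
    rw [Metric.continuousAt_iff']
    intro r hr
    filter_upwards [hmod z r hr] with x hx
    rw [Real.dist_eq]; exact hx k
  have hbd : ∀ k x, |v k x| ≤ (∫ y, gK n ε y) + b * Mp := by
    intro k x
    refine (cheap_holder hp (hgi x) (hg x) (hup k)).trans ?_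
    simp_rw [abs_of_pos (gK_pos n hε _)]
    rw [integral_sub_left_eq_self (gK n ε) volume x]
    gcongr
    exact hM k
  have : CompactSpace K := isCompact_iff_compactSpace.1 hK
  let F : ℕ → BoundedContinuousFunction K ℝ := fun k =>
    BoundedContinuousFunction.mkOfCompact ⟨fun x => v k x, (hcont k).comp continuous_subtype_val⟩
  have hF : ∀ k (x : K), F k x = v k x := fun k x => rfl
  have hcomp := BoundedContinuousFunction.arzela_ascoli (α := K) (β := ℝ)
    (Set.Icc (-((∫ y, gK n ε y) + b * Mp)) ((∫ y, gK n ε y) + b * Mp)) isCompact_Icc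
    (Set.range F) (by
      rintro _ x ⟨k, rfl⟩
      exact abs_le.1 (hbd k x)) (by
      intro z
      rw [Metric.equicontinuousAt_iff_right]
      intro r hr
      have := (continuous_subtype_val.tendsto z).eventually (hmod z r hr)
      filter_upwards [this] with x hx
      rintro ⟨_, k, rfl⟩
      rw [dist_comm, Real.dist_eq]
      exact hx k)
  have htb : TotallyBounded (Set.range F) := hcomp.totallyBounded.subset subset_closure
  obtain ⟨t, hts, htf, htc⟩ := Metric.finite_approx_of_totallyBounded htb δ hδ
  choose! g hg' using fun f (hf : f ∈ t) => hts hf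
  refine ⟨g '' t, htf.image g, fun k => ?_⟩
  obtain ⟨f, hft, hfk⟩ := Set.mem_iUnion₂.1 (htc ⟨k, rfl⟩)
  refine ⟨g f, ⟨f, hft, rfl⟩, fun x hx => ?_⟩
  rw [hvx, hvx]
  rw [Metric.mem_ball, ← hg' f hft] at hfk
  have := (BoundedContinuousFunction.dist_coe_le_dist (f := F k) (g := F (g f)) ⟨x, hx⟩).trans hfk.le
  rwa [Real.dist_eq] at this

/-! ### Conclusion -/

lemma core_compact {n : ℕ} (hn : 1 ≤ n) {s p : ℝ} (hs0 : 0 < s) (hs1 : s < 1)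
    (hp : 1 ≤ p) (hsp : s * p < n)
    (Ω : Set (EuclideanSpace ℝ (Fin n)))
    (hΩbdd : Bornology.IsBounded Ω)
    {q : ℝ} (hpq : p ≤ q) (hq' : q < n * p / (n - s * p))
    (u : ℕ → EuclideanSpace ℝ (Fin n) → ℝ)
    (husmooth : ∀ k, ContDiff ℝ (⊤ : ℕ∞) (u k))
    (husupp : ∀ k, HasCompactSupport (u k))
    (hbdd : (⨆ k, eLpNorm (u k) (ENNReal.ofReal p) volume
        + eLpNorm (rieszGrad n s (u k)) (ENNReal.ofReal p) volume) < ⊤) :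
    ∃ (φ : ℕ → ℕ) (f : EuclideanSpace ℝ (Fin n) → ℝ), StrictMono φ ∧
      AEStronglyMeasurable f (volume.restrict Ω) ∧
      Tendsto (fun j => eLpNorm (fun x => u (φ j) x - f x) (ENNReal.ofReal q)
        (volume.restrict Ω)) atTop (nhds 0) := by
  have hp0 : 0 < p := by linarith
  have hq0 : 0 < q := by linarith
  set μ := (volume : Measure (EuclideanSpace ℝ (Fin n))).restrict Ω with hμ
  set Q := ENNReal.ofReal q with hQ
  set S := (⨆ k, eLpNorm (u k) (ENNReal.ofReal p) volume
        + eLpNorm (rieszGrad n s (u k)) (ENNReal.ofReal p) volume) with hS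
  have hS1 : ∀ k, eLpNorm (u k) (ENNReal.ofReal p) volume ≤ S := fun k =>
    le_trans le_self_add (le_iSup (fun k => eLpNorm (u k) (ENNReal.ofReal p) volume
        + eLpNorm (rieszGrad n s (u k)) (ENNReal.ofReal p) volume) k)
  have hS2 : ∀ k, eLpNorm (rieszGrad n s (u k)) (ENNReal.ofReal p) volume ≤ S := fun k =>
    le_trans le_add_self (le_iSup (fun k => eLpNorm (u k) (ENNReal.ofReal p) volume
        + eLpNorm (rieszGrad n s (u k)) (ENNReal.ofReal p) volume) k)
  have hfin : IsFiniteMeasure μ := ⟨by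
    rw [hμ, Measure.restrict_apply_univ]; exact hΩbdd.measure_lt_top⟩
  have hQ1 : Fact (1 ≤ Q) := ⟨by rw [hQ]; simpa using hp.trans hpq⟩
  have hmem : ∀ k, MemLp (u k) Q μ := fun k =>
    ((husmooth k).continuous.memLp_of_hasCompactSupport (husupp k)).restrict Ω
  -- p-th moments
  have hmemp : ∀ k, MemLp (u k) (ENNReal.ofReal p) volume := fun k =>
    (husmooth k).continuous.memLp_of_hasCompactSupport (husupp k)
  have hup : ∀ k, Integrable (fun y => |u k y| ^ p) := fun k => by
    have := (hmemp k).integrable_norm_rpow (by simpa using hp0) (by simp)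
    simpa only [ENNReal.toReal_ofReal hp0.le, Real.norm_eq_abs] using this
  have hM : ∀ k, ∫ y, |u k y| ^ p ≤ S.toReal ^ p := fun k => by
    have h1 := (hmemp k).eLpNorm_eq_integral_rpow_norm (by simpa using hp0) (by simp)
    have h2 := hS1 k
    rw [h1, ENNReal.toReal_ofReal hp0.le] at h2
    simp only [Real.norm_eq_abs] at h2
    have h3 := (ENNReal.ofReal_le_iff_le_toReal hbdd.ne).1 h2
    have h0 : 0 ≤ ∫ y, |u k y| ^ p := integral_nonneg fun y => by positivity
    have h4 := Real.rpow_le_rpow (by positivity) h3 hp0.le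
    rwa [← Real.rpow_mul h0, inv_mul_cancel₀ hp0.ne', Real.rpow_one] at h4
  obtain ⟨ω, hω0, hω⟩ := lq_bound hn hs0 hs1 hp hsp hpq hq'
  let U : ℕ → Lp ℝ Q μ := fun k => (hmem k).toLp (u k)
  have htb : TotallyBounded (Set.range U) := by
    rw [Metric.totallyBounded_iff]
    intro δ hδ
    -- choose the regularisation scale
    have h1 : Tendsto (fun ε => ω ε * S) (nhdsWithin 0 (Set.Ioi 0)) (nhds 0) := by
      simpa using ENNReal.Tendsto.mul_const hω0 (Or.inr hbdd.ne)
    have h2 : ∀ᶠ ε in nhdsWithin (0:ℝ) (Set.Ioi 0), ω ε * S < ENNReal.ofReal (δ / 4) :=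
      h1.eventually (gt_mem_nhds (ENNReal.ofReal_pos.2 (by positivity)))
    obtain ⟨ε, hε1, hε⟩ := (h2.and self_mem_nhdsWithin).exists
    have hε0 : 0 < ε := hε
    set m := (μ Set.univ ^ (Q.toReal⁻¹)).toReal with hm
    have hm0 : 0 ≤ m := ENNReal.toReal_nonneg
    have hmt : μ Set.univ ^ (Q.toReal⁻¹) ≠ ⊤ :=
      ENNReal.rpow_ne_top_of_nonneg (by positivity) (measure_ne_top _ _)
    set η := δ / 4 / (m + 1) with hη
    have hη0 : 0 < η := by positivity
    have hηm : m * η ≤ δ / 4 := by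
      have : (m + 1) * η = δ / 4 := by rw [hη]; field_simp
      nlinarith
    obtain ⟨T, hT, hTn⟩ := net_exists hp hε0 (closure Ω) hΩbdd.isCompact_closure u
      (fun k => (husmooth k).continuous) (fun k => u_int (husmooth k) (husupp k)) hup hM hη0
    refine ⟨U '' T, hT.image U, ?_⟩
    rintro _ ⟨k, rfl⟩
    obtain ⟨j, hjT, hj⟩ := hTn k
    refine Set.mem_iUnion₂.2 ⟨U j, ⟨j, hjT, rfl⟩, ?_⟩
    rw [Metric.mem_ball, ← edist_lt_ofReal, Lp.edist_toLp_toLp]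
    set v : ℕ → EuclideanSpace ℝ (Fin n) → ℝ := fun k x => ∫ y, gK n ε y * u k (x - y) with hv
    have hvc : ∀ k, Continuous (v k) := fun k =>
      (cv_props (integrable_gK n hε0) (u_int (husmooth k) (husupp k)) (husmooth k).continuous
        ((husupp k).exists_bound_of_continuous (husmooth k).continuous)).1
    have b1 : ∀ k, eLpNorm (fun x => u k x - v k x) Q μ ≤ ENNReal.ofReal (δ / 4) := fun k =>
      calc _ ≤ eLpNorm (fun x => u k x - v k x) Q volume :=
            eLpNorm_mono_measure _ Measure.restrict_le_self
        _ ≤ ω ε * eLpNorm (rieszGrad n s (u k)) (ENNReal.ofReal p) volume :=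
            hω ε hε0 (u k) (husmooth k) (husupp k)
        _ ≤ ω ε * S := by gcongr; exact hS2 k
        _ ≤ _ := hε1.le
    have b2 : eLpNorm (fun x => v k x - v j x) Q μ ≤ ENNReal.ofReal (δ / 4) := by
      have hae : ∀ᵐ x ∂μ, ‖v k x - v j x‖ ≤ η := by
        have hcl : ∀ᵐ x ∂((volume : Measure (EuclideanSpace ℝ (Fin n))).restrict (closure Ω)),
            ‖v k x - v j x‖ ≤ η := by
          filter_upwards [ae_restrict_mem isClosed_closure.measurableSet] with x hx
          exact hj x hx
        exact ae_mono (Measure.restrict_mono subset_closure le_rfl) hcl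
      refine (eLpNorm_le_of_ae_bound hae).trans ?_
      rw [← ENNReal.ofReal_toReal hmt, ← ENNReal.ofReal_mul ENNReal.toReal_nonneg]
      exact ENNReal.ofReal_le_ofReal hηm
    have hsplit : u k - u j = (fun x => u k x - v k x) + (fun x => v k x - v j x) -
        (fun x => u j x - v j x) := by
      ext x; simp only [Pi.sub_apply, Pi.add_apply]; ring
    have hum : ∀ k, AEStronglyMeasurable (fun x => u k x - v k x) μ := fun k =>
      ((husmooth k).continuous.sub (hvc k)).aestronglyMeasurable
    have hvm : AEStronglyMeasurable (fun x => v k x - v j x) μ :=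
      ((hvc k).sub (hvc j)).aestronglyMeasurable
    rw [hsplit]
    calc _ ≤ eLpNorm ((fun x => u k x - v k x) + (fun x => v k x - v j x)) Q μ +
          eLpNorm (fun x => u j x - v j x) Q μ :=
          eLpNorm_sub_le ((hum k).add hvm) (hum j) hQ1.out
      _ ≤ (eLpNorm (fun x => u k x - v k x) Q μ + eLpNorm (fun x => v k x - v j x) Q μ) +
          eLpNorm (fun x => u j x - v j x) Q μ := by
          gcongr
          exact eLpNorm_add_le (hum k) hvm hQ1.out
      _ ≤ (ENNReal.ofReal (δ / 4) + ENNReal.ofReal (δ / 4)) + ENNReal.ofReal (δ / 4) := by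
          gcongr
          · exact b1 k
          · exact b1 j
      _ < ENNReal.ofReal δ := by
          rw [← ENNReal.ofReal_add (by positivity) (by positivity),
            ← ENNReal.ofReal_add (by positivity) (by positivity)]
          exact (ENNReal.ofReal_lt_ofReal_iff hδ).2 (by linarith)
  have hcl : IsCompact (closure (Set.range U)) := htb.closure.isCompact_of_isClosed isClosed_closure
  obtain ⟨f, -, φ, hφ, hlim⟩ := hcl.tendsto_subseq (x := U) (fun k => subset_closure ⟨k, rfl⟩)
  refine ⟨φ, f, hφ, Lp.aestronglyMeasurable f, ?_⟩
  have h := tendsto_iff_edist_tendsto_0.1 hlim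
  refine h.congr fun j => ?_
  rw [Lp.edist_def]
  refine eLpNorm_congr_ae ?_
  filter_upwards [(hmem (φ j)).coeFn_toLp] with x hx
  simp only [Pi.sub_apply, Function.comp_apply, U, hx]

/-- Compact embedding `H^{s,p}(ℝⁿ) ↪↪ L^q(Ω)`, subcritical case `sp < n`,
`1 ≤ q < p_s^* = np/(n-sp)`. -/
theorem bessel_compact_embedding_subcritical
    (n : ℕ) (hn : 1 ≤ n) (s p : ℝ) (hs0 : 0 < s) (hs1 : s < 1)
    (hp : 1 ≤ p) (hsp : s * p < n)
    (Ω : Set (EuclideanSpace ℝ (Fin n))) (hΩopen : IsOpen Ω)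
    (hΩbdd : Bornology.IsBounded Ω)
    (q : ℝ) (hq : 1 ≤ q) (hq' : q < n * p / (n - s * p))
    (u : ℕ → EuclideanSpace ℝ (Fin n) → ℝ)
    (husmooth : ∀ k, ContDiff ℝ (⊤ : ℕ∞) (u k))
    (husupp : ∀ k, HasCompactSupport (u k))
    (hbdd : (⨆ k, eLpNorm (u k) (ENNReal.ofReal p) volume
        + eLpNorm (rieszGrad n s (u k)) (ENNReal.ofReal p) volume) < ⊤) :
    ∃ (φ : ℕ → ℕ) (f : EuclideanSpace ℝ (Fin n) → ℝ), StrictMono φ ∧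
      Tendsto (fun j => eLpNorm (fun x => u (φ j) x - f x) (ENNReal.ofReal q)
        (volume.restrict Ω)) atTop (nhds 0) := by
  have hpos : 0 < (n : ℝ) - s * p := by linarith
  have hp0 : 0 < p := by linarith
  have hq0 : 0 < q := by linarith
  have hpp : p < n * p / (n - s * p) := by
    rw [lt_div_iff₀ hpos]
    nlinarith [mul_pos hs0 (mul_pos hp0 hp0)]
  obtain ⟨φ, f, hφ, hfm, hlim⟩ := core_compact hn hs0 hs1 hp hsp Ω hΩbdd (le_max_right q p)
    (max_lt hq' hpp) u husmooth husupp hbdd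
  refine ⟨φ, f, hφ, ?_⟩
  have hfin : IsFiniteMeasure ((volume : Measure (EuclideanSpace ℝ (Fin n))).restrict Ω) := ⟨by
    rw [Measure.restrict_apply_univ]; exact hΩbdd.measure_lt_top⟩
  set c := ((volume : Measure (EuclideanSpace ℝ (Fin n))).restrict Ω) Set.univ ^
    (1 / (ENNReal.ofReal q).toReal - 1 / (ENNReal.ofReal (max q p)).toReal) with hc
  have hct : c ≠ ⊤ := by
    refine ENNReal.rpow_ne_top_of_nonneg ?_ (measure_ne_top _ _)
    rw [ENNReal.toReal_ofReal hq0.le, ENNReal.toReal_ofReal (hq0.le.trans (le_max_left _ _))]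
    exact sub_nonneg.2 (one_div_le_one_div_of_le hq0 (le_max_left _ _))
  have h0 := ENNReal.Tendsto.mul_const hlim (Or.inr hct)
  rw [zero_mul] at h0
  refine tendsto_of_tendsto_of_tendsto_of_le_of_le tendsto_const_nhds h0 (fun _ => zero_le)
    fun j => ?_
  exact eLpNorm_le_eLpNorm_mul_rpow_measure_univ
    (ENNReal.ofReal_le_ofReal (le_max_left q p))
    ((husmooth (φ j)).continuous.aestronglyMeasurable.sub hfm)

end
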